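/- arXiv:2604.01269 — 2 statements merged into one kernel-verified Lean document; each statement's English description precedes it below -/
import Mathlib

section
/- Whether a path π starting in the initial state of a thread-register model is B-⌣_C-just (for C ∈ {T, S, I, A}) is completely determined by the set of actions thread-enabled by π together with the occurrence-count function occ_π : Act → ℕ ∪ {∞} giving how often each action occurs in π. In particular, if two paths π, π' thread-enable the same actions and occ_π = occ_{π'}, then π is B-⌣_C-just iff π' is. -/
section Basic

variable {S A : Type*}

/-- A finite-or-infinite path: states, actions, and a length in `ℕ∞`. -/
structure RawPath (S A : Type*) where
  states : ℕ → S
  acts : ℕ → A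
  len : ℕ∞

/-- An action `a` is enabled in state `s`. -/
def EnabledIn (Tr : S → A → S → Prop) (a : A) (s : S) : Prop := ∃ s', Tr s a s'

/-- `π` is a path of the LTS `Tr` starting in `s0`. -/
def IsPathOf (Tr : S → A → S → Prop) (s0 : S) (π : RawPath S A) : Prop :=
  π.states 0 = s0 ∧ ∀ i : ℕ, (i : ℕ∞) < π.len → Tr (π.states i) (π.acts i) (π.states (i + 1))

/-- `B`-`conc`-justness: for each suffix of `π`, if a non-blockable action `a` is enabled
in its initial state, then an action interfering with `a` occurs in the suffix. -/
def JustPath (Tr : S → A → S → Prop) (conc : A → A → Prop) (B : Set A)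
    (π : RawPath S A) : Prop :=
  ∀ (k : ℕ) (a : A), (k : ℕ∞) ≤ π.len → a ∉ B → EnabledIn Tr a (π.states k) →
    ∃ j : ℕ, k ≤ j ∧ (j : ℕ∞) < π.len ∧ ¬ conc a (π.acts j)

/-- The number of occurrences of action `a` on the path `π`, in `ℕ∞`. -/
noncomputable def occCount (π : RawPath S A) (a : A) : ℕ∞ :=
  Set.encard {j : ℕ | (j : ℕ∞) < π.len ∧ π.acts j = a}

/-- `w` is the weak trace `ℓ⁻(π)`: the subsequence of `vis`-actions of `π`, in order. -/
def IsEllMinus (vis : A → Prop) (π : RawPath S A) (w : ℕ → Option A) : Prop :=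
  ∃ (m : ℕ∞) (f : ℕ → ℕ),
    (∀ i j : ℕ, (i : ℕ∞) < m → (j : ℕ∞) < m → i < j → f i < f j) ∧
    (∀ i : ℕ, (i : ℕ∞) < m →
      ((f i : ℕ∞) < π.len ∧ vis (π.acts (f i)) ∧ w i = some (π.acts (f i)))) ∧
    (∀ i : ℕ, ¬ (i : ℕ∞) < m → w i = none) ∧
    (∀ j : ℕ, (j : ℕ∞) < π.len → vis (π.acts j) → ∃ i : ℕ, (i : ℕ∞) < m ∧ f i = j)

/-- The set of weak `C`-complete traces of an LTS. -/
def WCT (Tr : S → A → S → Prop) (s0 : S) (Cjust : RawPath S A → Prop) (vis : A → Prop) :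
    Set (ℕ → Option A) :=
  {w | ∃ π : RawPath S A, IsPathOf Tr s0 π ∧ Cjust π ∧ IsEllMinus vis π w}

end Basic

/-- The actions of thread-register models: register interface actions, register-local
order actions, instant reads, and the thread-local actions (crit, noncrit, other). -/
inductive RWAct (T R : Type) (D : R → Type) : Type
  | startRead  (t : T) (r : R)
  | orderRead  (t : T) (r : R)
  | finishRead (t : T) (r : R) (d : D r)
  | startWrite (t : T) (r : R) (d : D r)
  | orderWrite (t : T) (r : R)
  | finishWrite (t : T) (r : R)
  | read (t : T) (r : R) (d : D r)
  | crit (t : T)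
  | noncrit (t : T)
  | tloc (t : T) (n : ℕ)

namespace RWAct

variable {T R : Type} {D : R → Type}

/-- The thread id of an action. -/
def thr : RWAct T R D → T
  | startRead t _ => t
  | orderRead t _ => t
  | finishRead t _ _ => t
  | startWrite t _ _ => t
  | orderWrite t _ => t
  | finishWrite t _ => t
  | read t _ _ => t
  | crit t => t
  | noncrit t => t
  | tloc t _ => t

/-- The register id of an action (`none` for thread-local actions). -/
def regOf : RWAct T R D → Option R
  | startRead _ r => some r
  | orderRead _ r => some r
  | finishRead _ r _ => some r
  | startWrite _ r _ => some r
  | orderWrite _ r => some r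
  | finishWrite _ r => some r
  | read _ r _ => some r
  | crit _ => none
  | noncrit _ => none
  | tloc _ _ => none

/-- Actions belonging to the alphabet of a thread (all but the register-local order actions). -/
def isThreadAct : RWAct T R D → Prop
  | orderRead _ _ => False
  | orderWrite _ _ => False
  | _ => True

/-- `read?`: `a` is the start of a read operation on register `r`. -/
def isReadStart (r : R) : RWAct T R D → Prop
  | startRead _ r' => r' = r
  | read _ r' _ => r' = r
  | _ => False

/-- `write?`: `a` is the start of a write operation on register `r`. -/
def isWriteStart (r : R) : RWAct T R D → Prop
  | startWrite _ r' _ => r' = r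
  | _ => False

/-- `a ∈ start(r)`. -/
def inStart (r : R) (a : RWAct T R D) : Prop := isReadStart r a ∨ isWriteStart r a

/-- The visible actions: `crit` and `noncrit`. -/
def IsVis : RWAct T R D → Prop
  | crit _ => True
  | noncrit _ => True
  | _ => False

/-- `a` is an (instant) read action. -/
def isReadAct : RWAct T R D → Prop
  | read _ _ _ => True
  | _ => False

end RWAct

/-- The local state of a register. -/
structure RegState (T D : Type) where
  stor : D
  rds : Set T
  wrts : Set T
  pend : Set T
  recv : T → D

/-- The four memory models: `FR` (arbitrary overlap), `A` (blocking reads and writes),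
`I` (blocking model with concurrent reads), `S` (blocking writes, non-blocking reads). -/
inductive OverlapMode : Type
  | FR | A | I | S

/-- The guard for start-read actions in each memory model. -/
def gRead {T D : Type} : OverlapMode → RegState T D → T → Prop
  | OverlapMode.FR, s, t => t ∉ s.rds ∧ t ∉ s.wrts
  | OverlapMode.A, s, _ => s.rds = ∅ ∧ s.wrts = ∅
  | OverlapMode.I, s, t => t ∉ s.rds ∧ s.wrts = ∅
  | OverlapMode.S, s, t => t ∉ s.rds ∧ s.wrts = ∅

/-- The guard for start-write actions in each memory model. -/
def gWrite {T D : Type} : OverlapMode → RegState T D → T → Prop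
  | OverlapMode.FR, s, t => t ∉ s.rds ∧ t ∉ s.wrts
  | OverlapMode.A, s, _ => s.rds = ∅ ∧ s.wrts = ∅
  | OverlapMode.I, s, _ => s.rds = ∅ ∧ s.wrts = ∅
  | OverlapMode.S, s, _ => s.wrts = ∅

/-- A family of thread LTSs, one per thread id. -/
structure ThreadSys (T R : Type) (D : R → Type) where
  TS : T → Type
  init : ∀ t, TS t
  tr : ∀ t, TS t → RWAct T R D → TS t → Prop

/-- A state of the thread-register model: a state per thread and per register. -/
structure MState {T R : Type} {D : R → Type} (Θ : ThreadSys T R D) where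
  th : ∀ t, Θ.TS t
  rg : ∀ r, RegState T (D r)

section Comp

variable {T R : Type} {D : R → Type} [DecidableEq T]

/-- The thread interference relation `⌣_T`. -/
def concT (a b : RWAct T R D) : Prop := a.thr ≠ b.thr

/-- The signalling reads relation `⌣_S`. -/
def concS (a b : RWAct T R D) : Prop :=
  concT a b ∧ ¬ ∃ r, RWAct.inStart r a ∧ RWAct.isWriteStart r b

/-- The interfering reads relation `⌣_I`. -/
def concI (a b : RWAct T R D) : Prop :=
  concS a b ∧ ¬ ∃ r, RWAct.isWriteStart r a ∧ RWAct.isReadStart r b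

/-- The all interfering relation `⌣_A`. -/
def concA (a b : RWAct T R D) : Prop :=
  concI a b ∧ ¬ ∃ r, RWAct.isReadStart r a ∧ RWAct.isReadStart r b

/-- The concurrency relation matching each memory model. -/
def concOf : OverlapMode → RWAct T R D → RWAct T R D → Prop
  | OverlapMode.FR => concT
  | OverlapMode.A => concA
  | OverlapMode.I => concI
  | OverlapMode.S => concS

/-- The blockable actions: a thread may stay in its non-critical section forever. -/
def Blk : Set (RWAct T R D) := {a | ∃ t : T, a = RWAct.noncrit t}

/-- The full-read atomic register LTS for register `r` (with start guards given by the
memory model `mode`; `FR` is the unrestricted model). -/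
inductive AtoTrans (mode : OverlapMode) (r : R) :
    RegState T (D r) → RWAct T R D → RegState T (D r) → Prop
  | startRead (s : RegState T (D r)) (t : T) (h : gRead mode s t) :
      AtoTrans mode r s (RWAct.startRead t r)
        { s with rds := insert t s.rds, pend := insert t s.pend }
  | orderRead (s : RegState T (D r)) (t : T) (h1 : t ∈ s.rds) (h2 : t ∈ s.pend) :
      AtoTrans mode r s (RWAct.orderRead t r)
        { s with pend := s.pend \ {t}, recv := Function.update s.recv t s.stor }
  | finishRead (s : RegState T (D r)) (t : T) (h1 : t ∈ s.rds) (h2 : t ∉ s.pend) :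
      AtoTrans mode r s (RWAct.finishRead t r (s.recv t)) { s with rds := s.rds \ {t} }
  | startWrite (s : RegState T (D r)) (t : T) (d : D r) (h : gWrite mode s t) :
      AtoTrans mode r s (RWAct.startWrite t r d)
        { s with wrts := insert t s.wrts, pend := insert t s.pend,
                 recv := Function.update s.recv t d }
  | orderWrite (s : RegState T (D r)) (t : T) (h1 : t ∈ s.wrts) (h2 : t ∈ s.pend) :
      AtoTrans mode r s (RWAct.orderWrite t r)
        { s with pend := s.pend \ {t}, stor := s.recv t }
  | finishWrite (s : RegState T (D r)) (t : T) (h1 : t ∈ s.wrts) (h2 : t ∉ s.pend) :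
      AtoTrans mode r s (RWAct.finishWrite t r) { s with wrts := s.wrts \ {t} }

/-- The instant-read atomic register LTS for register `r`. -/
inductive IRAtoTrans (r : R) :
    RegState T (D r) → RWAct T R D → RegState T (D r) → Prop
  | read (s : RegState T (D r)) (t : T) (h : t ∉ s.wrts) :
      IRAtoTrans r s (RWAct.read t r s.stor) s
  | startWrite (s : RegState T (D r)) (t : T) (d : D r) (h : t ∉ s.wrts) :
      IRAtoTrans r s (RWAct.startWrite t r d)
        { s with wrts := insert t s.wrts, pend := insert t s.pend,
                 recv := Function.update s.recv t d }
  | orderWrite (s : RegState T (D r)) (t : T) (h1 : t ∈ s.wrts) (h2 : t ∈ s.pend) :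
      IRAtoTrans r s (RWAct.orderWrite t r)
        { s with pend := s.pend \ {t}, stor := s.recv t }
  | finishWrite (s : RegState T (D r)) (t : T) (h1 : t ∈ s.wrts) (h2 : t ∉ s.pend) :
      IRAtoTrans r s (RWAct.finishWrite t r) { s with wrts := s.wrts \ {t} }

/-- The requirements on (full-read) thread LTSs: threads only perform their own
thread-type actions; after invoking a read they only await its response and accept all
domain values; after invoking a write they only await its response; and operation
responses occur only immediately after the matching invocation. -/
def ThreadSys.Good (Θ : ThreadSys T R D) : Prop :=
  (∀ t (s : Θ.TS t) a s', Θ.tr t s a s' → RWAct.thr a = t ∧ RWAct.isThreadAct a) ∧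
  (∀ t (s s' : Θ.TS t) t' r (d : D r), ¬ Θ.tr t s (RWAct.read t' r d) s') ∧
  (∀ t r (s m : Θ.TS t), Θ.tr t s (RWAct.startRead t r) m →
      (∀ d : D r, ∃ s', Θ.tr t m (RWAct.finishRead t r d) s') ∧
      (∀ a s', Θ.tr t m a s' → ∃ d : D r, a = RWAct.finishRead t r d)) ∧
  (∀ t r (d : D r) (s m : Θ.TS t), Θ.tr t s (RWAct.startWrite t r d) m →
      (∃ s', Θ.tr t m (RWAct.finishWrite t r) s') ∧
      (∀ a s', Θ.tr t m a s' → a = RWAct.finishWrite t r)) ∧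
  (∀ t r (d : D r) (s s' : Θ.TS t), Θ.tr t s (RWAct.finishRead t r d) s' →
      ∀ (s0 : Θ.TS t) a, Θ.tr t s0 a s → a = RWAct.startRead t r) ∧
  (∀ t r (s s' : Θ.TS t), Θ.tr t s (RWAct.finishWrite t r) s' →
      ∀ (s0 : Θ.TS t) a, Θ.tr t s0 a s → ∃ d : D r, a = RWAct.startWrite t r d)

/-- The instant-read transform of a full-read thread system: each instant read action
abbreviates a start-read immediately followed by the matching finish-read. -/
def ThreadSys.toIR (Θ : ThreadSys T R D) : ThreadSys T R D :=
  { TS := Θ.TS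
    init := Θ.init
    tr := fun t s a s' =>
      ((∀ t' r, a ≠ RWAct.startRead t' r) ∧
       (∀ t' r (d : D r), a ≠ RWAct.finishRead t' r d) ∧
       Θ.tr t s a s') ∨
      (∃ (r : R) (d : D r) (m : Θ.TS t), a = RWAct.read t r d ∧
         Θ.tr t s (RWAct.startRead t r) m ∧ Θ.tr t m (RWAct.finishRead t r d) s') }

/-- The CSP-style parallel composition of the thread LTSs with the (full-read) atomic
register LTSs, for the memory model `mode`. -/
def MTrans (mode : OverlapMode) (Θ : ThreadSys T R D) :
    MState Θ → RWAct T R D → MState Θ → Prop := fun s a s' =>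
  (∀ t, (RWAct.thr a = t ∧ RWAct.isThreadAct a → Θ.tr t (s.th t) a (s'.th t)) ∧
        (¬ (RWAct.thr a = t ∧ RWAct.isThreadAct a) → s'.th t = s.th t)) ∧
  (∀ r, (RWAct.regOf a = some r → AtoTrans mode r (s.rg r) a (s'.rg r)) ∧
        (RWAct.regOf a ≠ some r → s'.rg r = s.rg r))

/-- The CSP-style parallel composition with the instant-read atomic register LTSs. -/
def MTransIR (Θ : ThreadSys T R D) :
    MState Θ → RWAct T R D → MState Θ → Prop := fun s a s' =>
  (∀ t, (RWAct.thr a = t ∧ RWAct.isThreadAct a → Θ.tr t (s.th t) a (s'.th t)) ∧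
        (¬ (RWAct.thr a = t ∧ RWAct.isThreadAct a) → s'.th t = s.th t)) ∧
  (∀ r, (RWAct.regOf a = some r → IRAtoTrans r (s.rg r) a (s'.rg r)) ∧
        (RWAct.regOf a ≠ some r → s'.rg r = s.rg r))

/-- The initial state of the thread-register model, with register initial values `d0`. -/
def Minit (Θ : ThreadSys T R D) (d0 : ∀ r, D r) : MState Θ :=
  { th := Θ.init
    rg := fun r => { stor := d0 r, rds := ∅, wrts := ∅, pend := ∅, recv := fun _ => d0 r } }

/-- `a` is thread-enabled by `π`: only finitely many actions of `a`'s thread occur on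
`π`, and `a` is enabled in the component state of that thread after its last action. -/
def ThreadEnabled (Θ : ThreadSys T R D) (π : RawPath (MState Θ) (RWAct T R D))
    (a : RWAct T R D) : Prop :=
  ∃ k : ℕ, (k : ℕ∞) ≤ π.len ∧
    (∀ j : ℕ, k ≤ j → (j : ℕ∞) < π.len → RWAct.thr (π.acts j) ≠ RWAct.thr a) ∧
    ∃ s', Θ.tr (RWAct.thr a) ((π.states k).th (RWAct.thr a)) a s'

/-- `π'` arises from `π` by the `i2f` transformation on action sequences: each instant
read is replaced by the sequence start-read · order-read · finish-read, other actions
are kept. -/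
def IsI2F {S₁ S₂ : Type*} (π : RawPath S₁ (RWAct T R D)) (π' : RawPath S₂ (RWAct T R D)) :
    Prop :=
  ∃ f : ℕ → ℕ, f 0 = 0 ∧
    (∀ k : ℕ, (k : ℕ∞) < π.len →
      ((¬ RWAct.isReadAct (π.acts k) ∧ π'.acts (f k) = π.acts k ∧ f (k + 1) = f k + 1) ∨
       (∃ (t : T) (r : R) (d : D r), π.acts k = RWAct.read t r d ∧
          π'.acts (f k) = RWAct.startRead t r ∧
          π'.acts (f k + 1) = RWAct.orderRead t r ∧
          π'.acts (f k + 2) = RWAct.finishRead t r d ∧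
          f (k + 1) = f k + 3))) ∧
    (π.len = ⊤ → π'.len = ⊤) ∧
    (∀ n : ℕ, π.len = (n : ℕ∞) → π'.len = ((f n : ℕ) : ℕ∞))

end Comp

section Determination

variable {T R : Type} {D : R → Type}

/-- `a` is the response to a read or write operation. -/
def RWAct.IsFinish : RWAct T R D → Prop
  | RWAct.finishRead _ _ _ => True
  | RWAct.finishWrite _ _ => True
  | _ => False

/-- No action of thread `t` occurs on `π`. -/
def NeverActs {S : Type*} (π : RawPath S (RWAct T R D)) (t : T) : Prop :=
  ∀ j : ℕ, (j : ℕ∞) < π.len → (π.acts j).thr ≠ t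

/-- The positions of `π` carrying an action that satisfies `Q`. -/
def occIndices {S A : Type*} (π : RawPath S A) (Q : A → Prop) : Set ℕ :=
  {j : ℕ | (j : ℕ∞) < π.len ∧ Q (π.acts j)}

theorem image_acts_occIndices {S A : Type*} (π : RawPath S A) (Q : A → Prop) :
    π.acts '' occIndices π Q = {a | Q a ∧ occCount π a ≠ 0} := by
  ext a
  simp only [occIndices, occCount, Set.mem_image, Set.mem_ofPred_eq, ne_eq, Set.encard_eq_zero,
    ← Set.nonempty_iff_ne_empty]
  constructor
  · rintro ⟨j, ⟨hj, hQ⟩, rfl⟩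
    exact ⟨hQ, j, hj, rfl⟩
  · rintro ⟨hQ, j, hj, rfl⟩
    exact ⟨j, ⟨hj, hQ⟩, rfl⟩

theorem occIndices_finite_of_occCount_eq {S A : Type*} {π π' : RawPath S A}
    (h : ∀ a, occCount π a = occCount π' a) (Q : A → Prop)
    (hfin : (occIndices π Q).Finite) : (occIndices π' Q).Finite := by
  refine Set.Finite.of_finite_fibers π'.acts ?_ ?_
  · rw [image_acts_occIndices]
    simp_rw [← h]
    rw [← image_acts_occIndices]
    exact hfin.image _
  · rintro a ⟨j, ⟨hj, hQ⟩, rfl⟩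
    have hsub : {i : ℕ | (i : ℕ∞) < π.len ∧ π.acts i = π'.acts j} ⊆ occIndices π Q := by
      rintro i ⟨hi, hia⟩
      exact ⟨hi, hia ▸ hQ⟩
    have hlt : occCount π (π'.acts j) < ⊤ := Set.encard_lt_top_iff.2 (hfin.subset hsub)
    rw [h] at hlt
    refine (Set.encard_lt_top_iff.1 hlt).subset ?_
    rintro i ⟨⟨hi, -⟩, hia⟩
    exact ⟨hi, hia⟩

theorem occIndices_infinite_congr {S A : Type*} {π π' : RawPath S A}
    (h : ∀ a, occCount π a = occCount π' a) (Q : A → Prop) :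
    (occIndices π Q).Infinite ↔ (occIndices π' Q).Infinite :=
  not_congr ⟨occIndices_finite_of_occCount_eq h Q,
    occIndices_finite_of_occCount_eq (fun a => (h a).symm) Q⟩

theorem neverActs_of_occCount_eq {S : Type*} {π π' : RawPath S (RWAct T R D)}
    (h : ∀ a, occCount π a = occCount π' a) {t : T} (hn : NeverActs π t) :
    NeverActs π' t := by
  rintro j hj rfl
  have hmem : π'.acts j ∈ π'.acts '' occIndices π' (fun _ => True) := ⟨j, ⟨hj, trivial⟩, rfl⟩
  rw [image_acts_occIndices, Set.mem_ofPred_eq, ← h] at hmem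
  have hmem' : π'.acts j ∈ π.acts '' occIndices π (fun _ => True) := by
    rw [image_acts_occIndices]
    exact hmem
  obtain ⟨i, ⟨hi, -⟩, hia⟩ := hmem'
  exact hn i hi (by rw [hia])

/-- The phase thread `t` is in at state `s`: idle, awaiting the response to a read, or awaiting
the response to a write. The proposition `acted` says whether `t` has performed an action. -/
inductive ThreadPhase (Θ : ThreadSys T R D) (s : MState Θ) (t : T) (acted : Prop) : Prop
  | idle (hrg : ∀ r, t ∉ (s.rg r).rds ∧ t ∉ (s.rg r).wrts)
      (hlast : acted → ∃ p a, Θ.tr t p a (s.th t) ∧ ∀ r, ¬ RWAct.inStart r a)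
  | reading (r : R) (p : Θ.TS t) (htr : Θ.tr t p (RWAct.startRead t r) (s.th t))
      (hrds : ∀ r', t ∈ (s.rg r').rds ↔ r' = r) (hwrts : ∀ r', t ∉ (s.rg r').wrts)
      (hacted : acted)
  | writing (r : R) (d : D r) (p : Θ.TS t) (htr : Θ.tr t p (RWAct.startWrite t r d) (s.th t))
      (hrds : ∀ r', t ∉ (s.rg r').rds) (hwrts : ∀ r', t ∈ (s.rg r').wrts ↔ r' = r)
      (hacted : acted)

/-- Transitions that leave both the thread and the occupancy of the registers by `t` unchanged
preserve the phase. -/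
theorem ThreadPhase.congr {Θ : ThreadSys T R D} {s s' : MState Θ} {t : T} {p q : Prop}
    (h : ThreadPhase Θ s t p) (hth : s'.th t = s.th t)
    (hrds : ∀ r, t ∈ (s'.rg r).rds ↔ t ∈ (s.rg r).rds)
    (hwrts : ∀ r, t ∈ (s'.rg r).wrts ↔ t ∈ (s.rg r).wrts)
    (hpq : p → q) (hqp : (∀ r, t ∉ (s.rg r).rds ∧ t ∉ (s.rg r).wrts) → q → p) :
    ThreadPhase Θ s' t q := by
  cases h with
  | idle hrg hlast =>
    refine .idle (fun r => ?_) (fun hq => ?_)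
    · rw [hrds, hwrts]
      exact hrg r
    · rw [hth]
      exact hlast (hqp hrg hq)
  | reading r x htr h1 h2 ha =>
    refine .reading r x (hth ▸ htr) (fun r' => ?_) (fun r' => ?_) (hpq ha)
    · rw [hrds, h1]
    · rw [hwrts]
      exact h2 r'
  | writing r d x htr h1 h2 ha =>
    refine .writing r d x (hth ▸ htr) (fun r' => ?_) (fun r' => ?_) (hpq ha)
    · rw [hrds]
      exact h1 r'
    · rw [hwrts, h2]

/-- A thread that can do anything but respond is idle. -/
theorem ThreadPhase.idle_of_tr {Θ : ThreadSys T R D} (hΘ : Θ.Good) {s : MState Θ} {t : T}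
    {p : Prop} (h : ThreadPhase Θ s t p) {a : RWAct T R D} {x : Θ.TS t}
    (ha : Θ.tr t (s.th t) a x) (hfin : ¬ a.IsFinish) (r : R) :
    t ∉ (s.rg r).rds ∧ t ∉ (s.rg r).wrts := by
  cases h with
  | idle hrg _ => exact hrg r
  | reading r' y htr _ _ _ =>
    obtain ⟨d, rfl⟩ := (hΘ.2.2.1 t r' y _ htr).2 a x ha
    exact absurd trivial hfin
  | writing r' d y htr _ _ _ =>
    obtain rfl := (hΘ.2.2.2.1 t r' d y _ htr).2 a x ha
    exact absurd trivial hfin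

theorem ThreadPhase.reading_of_mem_rds {Θ : ThreadSys T R D} {s : MState Θ} {t : T} {p : Prop}
    (h : ThreadPhase Θ s t p) {r : R} (hr : t ∈ (s.rg r).rds) :
    (∃ x, Θ.tr t x (RWAct.startRead t r) (s.th t)) ∧
      (∀ r', t ∈ (s.rg r').rds ↔ r' = r) ∧ (∀ r', t ∉ (s.rg r').wrts) ∧ p := by
  cases h with
  | idle hrg _ => exact absurd hr (hrg r).1
  | reading r' x htr h1 h2 ha =>
    obtain rfl := (h1 r).1 hr
    exact ⟨⟨x, htr⟩, h1, h2, ha⟩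
  | writing r' d x htr h1 h2 ha => exact absurd hr (h1 r)

theorem ThreadPhase.writing_of_mem_wrts {Θ : ThreadSys T R D} {s : MState Θ} {t : T} {p : Prop}
    (h : ThreadPhase Θ s t p) {r : R} (hr : t ∈ (s.rg r).wrts) :
    (∃ d x, Θ.tr t x (RWAct.startWrite t r d) (s.th t)) ∧
      (∀ r', t ∉ (s.rg r').rds) ∧ (∀ r', t ∈ (s.rg r').wrts ↔ r' = r) ∧ p := by
  cases h with
  | idle hrg _ => exact absurd hr (hrg r).2
  | reading r' x htr h1 h2 ha => exact absurd hr (h2 r)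
  | writing r' d x htr h1 h2 ha =>
    obtain rfl := (h2 r).1 hr
    exact ⟨⟨d, x, htr⟩, h1, h2, ha⟩

theorem ThreadPhase.mem_rds_of_tr {Θ : ThreadSys T R D} (hΘ : Θ.Good) {s : MState Θ} {t : T}
    {p : Prop} (h : ThreadPhase Θ s t p) (hp : p) {r : R} {d : D r} {x : Θ.TS t}
    (ha : Θ.tr t (s.th t) (RWAct.finishRead t r d) x) : t ∈ (s.rg r).rds := by
  have key := hΘ.2.2.2.2.1 t r d _ x ha
  cases h with
  | idle hrg hlast =>
    obtain ⟨y, b, hb, hst⟩ := hlast hp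
    obtain rfl := key y b hb
    exact absurd (Or.inl rfl) (hst r)
  | reading r' y htr h1 _ _ =>
    have := key y _ htr
    simp only [RWAct.startRead.injEq, true_and] at this
    exact (h1 r).2 this.symm
  | writing r' d' y htr _ _ _ => exact absurd (key y _ htr) (by simp)

theorem ThreadPhase.mem_wrts_of_tr {Θ : ThreadSys T R D} (hΘ : Θ.Good) {s : MState Θ} {t : T}
    {p : Prop} (h : ThreadPhase Θ s t p) (hp : p) {r : R} {x : Θ.TS t}
    (ha : Θ.tr t (s.th t) (RWAct.finishWrite t r) x) : t ∈ (s.rg r).wrts := by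
  have key := hΘ.2.2.2.2.2 t r _ x ha
  cases h with
  | idle hrg hlast =>
    obtain ⟨y, b, hb, hst⟩ := hlast hp
    obtain ⟨d, rfl⟩ := key y b hb
    exact absurd (Or.inr rfl) (hst r)
  | reading r' y htr _ _ _ =>
    obtain ⟨d, hd⟩ := key y _ htr
    exact absurd hd (by simp)
  | writing r' d' y htr _ h2 _ =>
    obtain ⟨d, hd⟩ := key y _ htr
    simp only [RWAct.startWrite.injEq, true_and] at hd
    exact (h2 r).2 hd.1.symm

variable [DecidableEq T]

theorem AtoTrans.mem_iff_of_thr_ne {mode : OverlapMode} {r : R} {s s' : RegState T (D r)}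
    {b : RWAct T R D} (h : AtoTrans mode r s b s') {t : T} (ht : b.thr ≠ t) :
    (t ∈ s'.rds ↔ t ∈ s.rds) ∧ (t ∈ s'.wrts ↔ t ∈ s.wrts) := by
  cases h <;> simp_all [RWAct.thr, eq_comm]

theorem MTrans.mem_iff_of_thr_ne {mode : OverlapMode} {Θ : ThreadSys T R D} {s s' : MState Θ}
    {b : RWAct T R D} (h : MTrans mode Θ s b s') {t : T} (ht : b.thr ≠ t) (r : R) :
    (t ∈ (s'.rg r).rds ↔ t ∈ (s.rg r).rds) ∧ (t ∈ (s'.rg r).wrts ↔ t ∈ (s.rg r).wrts) := by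
  by_cases hr : b.regOf = some r
  · exact ((h.2 r).1 hr).mem_iff_of_thr_ne ht
  · rw [(h.2 r).2 hr]
    simp

theorem AtoTrans.startRead_inv {mode : OverlapMode} {r : R} {s s' : RegState T (D r)} {t : T}
    (h : AtoTrans mode r s (RWAct.startRead t r) s') :
    s'.rds = insert t s.rds ∧ s'.wrts = s.wrts := by
  cases h
  simp_all

theorem AtoTrans.startWrite_inv {mode : OverlapMode} {r : R} {s s' : RegState T (D r)}
    {t : T} {d : D r}
    (h : AtoTrans mode r s (RWAct.startWrite t r d) s') :
    s'.rds = s.rds ∧ s'.wrts = insert t s.wrts := by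
  cases h
  simp_all

theorem AtoTrans.finishRead_inv {mode : OverlapMode} {r : R} {s s' : RegState T (D r)}
    {t : T} {d : D r}
    (h : AtoTrans mode r s (RWAct.finishRead t r d) s') :
    t ∈ s.rds ∧ s'.rds = s.rds \ {t} ∧ s'.wrts = s.wrts := by
  cases h
  simp_all

theorem AtoTrans.finishWrite_inv {mode : OverlapMode} {r : R} {s s' : RegState T (D r)} {t : T}
    (h : AtoTrans mode r s (RWAct.finishWrite t r) s') :
    t ∈ s.wrts ∧ s'.rds = s.rds ∧ s'.wrts = s.wrts \ {t} := by
  cases h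
  simp_all

theorem AtoTrans.orderRead_inv {mode : OverlapMode} {r : R} {s s' : RegState T (D r)} {t : T}
    (h : AtoTrans mode r s (RWAct.orderRead t r) s') :
    t ∈ s.rds ∧ s'.rds = s.rds ∧ s'.wrts = s.wrts := by
  cases h
  simp_all

theorem AtoTrans.orderWrite_inv {mode : OverlapMode} {r : R} {s s' : RegState T (D r)} {t : T}
    (h : AtoTrans mode r s (RWAct.orderWrite t r) s') :
    t ∈ s.wrts ∧ s'.rds = s.rds ∧ s'.wrts = s.wrts := by
  cases h
  simp_all

theorem ThreadPhase.step_self {Θ : ThreadSys T R D} (hΘ : Θ.Good) {s s' : MState Θ}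
    {b : RWAct T R D} {p : Prop} (h : ThreadPhase Θ s b.thr p)
    (htr : MTrans OverlapMode.FR Θ s b s') : ThreadPhase Θ s' b.thr True := by
  have hact : b.isThreadAct → Θ.tr b.thr (s.th b.thr) b (s'.th b.thr) :=
    fun hb => (htr.1 b.thr).1 ⟨rfl, hb⟩
  have hstay : ¬ b.isThreadAct → s'.th b.thr = s.th b.thr :=
    fun hb => (htr.1 b.thr).2 fun hc => hb hc.2
  have hreg := htr.2
  have hloc : b.regOf = none → ¬ b.IsFinish → b.isThreadAct → ThreadPhase Θ s' b.thr True := by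
    intro hnone hfin hb
    refine .idle (fun r => ?_) fun _ => ⟨_, b, hact hb, fun r => ?_⟩
    · rw [(hreg r).2 (by simp [hnone])]
      exact h.idle_of_tr hΘ (hact hb) hfin r
    · cases b <;> simp_all [RWAct.inStart, RWAct.isReadStart, RWAct.isWriteStart, RWAct.regOf]
  have hother : ∀ r r', b.regOf = some r → r' ≠ r → s'.rg r' = s.rg r' := fun r r' hr hne =>
    (hreg r').2 (by rw [hr]; simpa using hne.symm)
  cases b with
  | startRead t r =>
    have hidle := h.idle_of_tr hΘ (hact trivial) id
    obtain ⟨h1, h2⟩ := ((hreg r).1 rfl).startRead_inv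
    refine .reading r _ (hact trivial) (fun r' => ?_) (fun r' => ?_) trivial <;>
      by_cases hr : r' = r
    · subst hr
      simp [h1, RWAct.thr]
    · rw [hother r r' rfl hr]
      simpa [hr] using (hidle r').1
    · subst hr
      rw [h2]
      exact (hidle r').2
    · rw [hother r r' rfl hr]
      exact (hidle r').2
  | startWrite t r d =>
    have hidle := h.idle_of_tr hΘ (hact trivial) id
    obtain ⟨h1, h2⟩ := ((hreg r).1 rfl).startWrite_inv
    refine .writing r d _ (hact trivial) (fun r' => ?_) (fun r' => ?_) trivial <;>
      by_cases hr : r' = r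
    · subst hr
      rw [h1]
      exact (hidle r').1
    · rw [hother r r' rfl hr]
      exact (hidle r').1
    · subst hr
      simp [h2, RWAct.thr]
    · rw [hother r r' rfl hr]
      simpa [hr] using (hidle r').2
  | finishRead t r d =>
    obtain ⟨hmem, h1, h2⟩ := ((hreg r).1 rfl).finishRead_inv
    obtain ⟨-, hr1, hr2, -⟩ := h.reading_of_mem_rds hmem
    refine .idle (fun r' => ?_) fun _ => ⟨_, _, hact trivial,
      fun r' => by rintro (h | h) <;> exact h⟩
    by_cases hr : r' = r
    · subst hr
      rw [h1, h2]
      exact ⟨fun hc => hc.2 rfl, hr2 r'⟩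
    · rw [hother r r' rfl hr]
      exact ⟨fun hc => hr ((hr1 r').1 hc), hr2 r'⟩
  | finishWrite t r =>
    obtain ⟨hmem, h1, h2⟩ := ((hreg r).1 rfl).finishWrite_inv
    obtain ⟨-, hr1, hr2, -⟩ := h.writing_of_mem_wrts hmem
    refine .idle (fun r' => ?_) fun _ => ⟨_, _, hact trivial,
      fun r' => by rintro (h | h) <;> exact h⟩
    by_cases hr : r' = r
    · subst hr
      rw [h1, h2]
      exact ⟨hr1 r', fun hc => hc.2 rfl⟩
    · rw [hother r r' rfl hr]
      exact ⟨hr1 r', fun hc => hr ((hr2 r').1 hc)⟩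
  | orderRead t r =>
    obtain ⟨hmem, h1, h2⟩ := ((hreg r).1 rfl).orderRead_inv
    refine h.congr (hstay id) (fun r' => ?_) (fun r' => ?_) (fun _ => trivial)
      (fun hi => absurd hmem (hi r).1) <;>
      by_cases hr : r' = r
    · subst hr
      rw [h1]
    · rw [hother r r' rfl hr]
    · subst hr
      rw [h2]
    · rw [hother r r' rfl hr]
  | orderWrite t r =>
    obtain ⟨hmem, h1, h2⟩ := ((hreg r).1 rfl).orderWrite_inv
    refine h.congr (hstay id) (fun r' => ?_) (fun r' => ?_) (fun _ => trivial)
      (fun hi => absurd hmem (hi r).2) <;>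
      by_cases hr : r' = r
    · subst hr
      rw [h1]
    · rw [hother r r' rfl hr]
    · subst hr
      rw [h2]
    · rw [hother r r' rfl hr]
  | read t r d => exact absurd (hact trivial) (hΘ.2.1 _ _ _ _ _ _)
  | crit t => exact hloc rfl id trivial
  | noncrit t => exact hloc rfl id trivial
  | tloc t n => exact hloc rfl id trivial

/-- Every thread is in one of its phases at every state of a path from the initial state. -/
theorem IsPathOf.threadPhase {Θ : ThreadSys T R D} (hΘ : Θ.Good) {d0 : ∀ r, D r}
    {π : RawPath (MState Θ) (RWAct T R D)}
    (hπ : IsPathOf (MTrans OverlapMode.FR Θ) (Minit Θ d0) π) (t : T) (k : ℕ)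
    (hk : (k : ℕ∞) ≤ π.len) :
    ThreadPhase Θ (π.states k) t (∃ j < k, (π.acts j).thr = t) := by
  induction k with
  | zero =>
    refine .idle (fun r => ?_) (by simp)
    rw [hπ.1]
    simp [Minit]
  | succ k ih =>
    have hlt : (k : ℕ∞) < π.len := lt_of_lt_of_le (by exact_mod_cast k.lt_succ_self) hk
    have htr := hπ.2 k hlt
    have hph := ih hlt.le
    by_cases ht : (π.acts k).thr = t
    · subst ht
      exact (hph.step_self hΘ htr).congr rfl (fun _ => Iff.rfl) (fun _ => Iff.rfl)
        (fun _ => ⟨k, k.lt_succ_self, rfl⟩) (fun _ _ => trivial)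
    · refine hph.congr ((htr.1 t).2 fun hc => ht hc.1) (fun r => (htr.mem_iff_of_thr_ne ht r).1)
        (fun r => (htr.mem_iff_of_thr_ne ht r).2) ?_ ?_
      · rintro ⟨j, hj, hjt⟩
        exact ⟨j, hj.trans k.lt_succ_self, hjt⟩
      · rintro - ⟨j, hj, hjt⟩
        rcases Nat.lt_succ_iff_lt_or_eq.1 hj with hj | rfl
        · exact ⟨j, hj, hjt⟩
        · exact absurd hjt ht

/-- The local state of a thread does not change while the thread does not act. -/
theorem IsPathOf.th_eq_of_forall_thr_ne {mode : OverlapMode} {Θ : ThreadSys T R D}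
    {s0 : MState Θ} {π : RawPath (MState Θ) (RWAct T R D)}
    (hπ : IsPathOf (MTrans mode Θ) s0 π) {t : T} {k : ℕ}
    (hne : ∀ j : ℕ, k ≤ j → (j : ℕ∞) < π.len → (π.acts j).thr ≠ t) {m : ℕ} (hkm : k ≤ m)
    (hm : (m : ℕ∞) ≤ π.len) : (π.states m).th t = (π.states k).th t := by
  induction m, hkm using Nat.le_induction with
  | base => rfl
  | succ m hkm ih =>
    have hlt : (m : ℕ∞) < π.len := lt_of_lt_of_le (by exact_mod_cast m.lt_succ_self) hm
    rw [((hπ.2 m hlt).1 t).2 fun hc => hne m hkm hlt hc.1, ih hlt.le]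

/-- An action is enabled in the composition once all participating components enable it. -/
theorem enabledIn_MTrans {mode : OverlapMode} {Θ : ThreadSys T R D} {s : MState Θ}
    {a : RWAct T R D}
    (hth : a.isThreadAct → ∃ x, Θ.tr a.thr (s.th a.thr) a x)
    (hreg : ∀ r, a.regOf = some r → ∃ q, AtoTrans mode r (s.rg r) a q) :
    EnabledIn (MTrans mode Θ) a s := by
  have h1 : ∀ t, ∃ x, (a.thr = t ∧ a.isThreadAct → Θ.tr t (s.th t) a x) ∧
      (¬ (a.thr = t ∧ a.isThreadAct) → x = s.th t) := by
    intro t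
    by_cases h : a.thr = t ∧ a.isThreadAct
    · obtain ⟨rfl, hact⟩ := h
      obtain ⟨x, hx⟩ := hth hact
      exact ⟨x, fun _ => hx, fun hc => absurd ⟨rfl, hact⟩ hc⟩
    · exact ⟨_, fun hc => absurd hc h, fun _ => rfl⟩
  have h2 : ∀ r, ∃ q, (a.regOf = some r → AtoTrans mode r (s.rg r) a q) ∧
      (a.regOf ≠ some r → q = s.rg r) := by
    intro r
    by_cases h : a.regOf = some r
    · obtain ⟨q, hq⟩ := hreg r h
      exact ⟨q, fun _ => hq, fun hc => absurd h hc⟩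
    · exact ⟨_, fun hc => absurd hc h, fun _ => rfl⟩
  choose f hf using h1
  choose g hg using h2
  exact ⟨⟨f, g⟩, hf, hg⟩

/-- An action other than a response that is enabled by the thread is enabled by the model. -/
theorem ThreadPhase.enabledIn_of_tr {Θ : ThreadSys T R D} (hΘ : Θ.Good) {s : MState Θ}
    {a : RWAct T R D} {p : Prop} (h : ThreadPhase Θ s a.thr p) {x : Θ.TS a.thr}
    (ha : Θ.tr a.thr (s.th a.thr) a x) (hfin : ¬ a.IsFinish) :
    EnabledIn (MTrans OverlapMode.FR Θ) a s := by
  refine enabledIn_MTrans (fun _ => ⟨x, ha⟩) fun r hr => ?_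
  have hidle := h.idle_of_tr hΘ ha hfin
  have hact := (hΘ.1 _ _ _ _ ha).2
  cases a with
  | startRead t r' =>
    obtain rfl : r' = r := Option.some.inj hr
    exact ⟨_, .startRead _ _ (hidle r')⟩
  | startWrite t r' d =>
    obtain rfl : r' = r := Option.some.inj hr
    exact ⟨_, .startWrite _ _ _ (hidle r')⟩
  | orderRead => exact hact.elim
  | orderWrite => exact hact.elim
  | finishRead => exact absurd trivial hfin
  | finishWrite => exact absurd trivial hfin
  | read t r' d => exact absurd ha (hΘ.2.1 _ _ _ _ _ _)
  | crit => cases hr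
  | noncrit => cases hr
  | tloc => cases hr

/-- If a thread that has acted awaits a response, then an action of this thread that is not
blockable and does not start an operation is enabled by the model. -/
theorem ThreadPhase.exists_enabledIn_of_isFinish {Θ : ThreadSys T R D} (hΘ : Θ.Good)
    {s : MState Θ} {a : RWAct T R D} {p : Prop} (h : ThreadPhase Θ s a.thr p) (hp : p)
    {x : Θ.TS a.thr} (ha : Θ.tr a.thr (s.th a.thr) a x) (hfin : a.IsFinish) :
    ∃ b : RWAct T R D, b.thr = a.thr ∧ b ∉ (Blk : Set (RWAct T R D)) ∧
      (∀ r, ¬ RWAct.inStart r b) ∧ EnabledIn (MTrans OverlapMode.FR Θ) b s := by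
  cases a with
  | finishRead t r d =>
    have hmem := h.mem_rds_of_tr hΘ hp ha
    by_cases hpend : t ∈ (s.rg r).pend
    · refine ⟨.orderRead t r, rfl, by simp [Blk], by rintro r' (h | h) <;> exact h,
        enabledIn_MTrans False.elim fun r' hr => ?_⟩
      obtain rfl : r = r' := Option.some.inj hr
      exact ⟨_, .orderRead _ _ hmem hpend⟩
    · obtain ⟨⟨y, hy⟩, -⟩ := h.reading_of_mem_rds hmem
      refine ⟨.finishRead t r ((s.rg r).recv t), rfl, by simp [Blk],
        by rintro r' (h | h) <;> exact h,
        enabledIn_MTrans (fun _ => (hΘ.2.2.1 _ _ _ _ hy).1 _) fun r' hr => ?_⟩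
      obtain rfl : r = r' := Option.some.inj hr
      exact ⟨_, .finishRead _ _ hmem hpend⟩
  | finishWrite t r =>
    have hmem := h.mem_wrts_of_tr hΘ hp ha
    by_cases hpend : t ∈ (s.rg r).pend
    · refine ⟨.orderWrite t r, rfl, by simp [Blk], by rintro r' (h | h) <;> exact h,
        enabledIn_MTrans False.elim fun r' hr => ?_⟩
      obtain rfl : r = r' := Option.some.inj hr
      exact ⟨_, .orderWrite _ _ hmem hpend⟩
    · refine ⟨.finishWrite t r, rfl, by simp [Blk], by rintro r' (h | h) <;> exact h,
        enabledIn_MTrans (fun _ => ⟨x, ha⟩) fun r' hr => ?_⟩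
      obtain rfl : r = r' := Option.some.inj hr
      exact ⟨_, .finishWrite _ _ hmem hpend⟩
  | _ => exact hfin.elim

/-- If a response or a register-local order action is enabled by the model, then its thread has
acted and awaits a response. -/
theorem ThreadPhase.acted_of_enabledIn {Θ : ThreadSys T R D} (hΘ : Θ.Good) {s : MState Θ}
    {a : RWAct T R D} {p : Prop} (h : ThreadPhase Θ s a.thr p)
    (ha : EnabledIn (MTrans OverlapMode.FR Θ) a s) (hfin : a.IsFinish ∨ ¬ a.isThreadAct) :
    p ∧ ∃ (b : RWAct T R D) (x : Θ.TS a.thr), b.thr = a.thr ∧ b.IsFinish ∧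
      Θ.tr a.thr (s.th a.thr) b x := by
  obtain ⟨s', -, hreg⟩ := ha
  cases a with
  | finishRead t r d =>
    obtain ⟨⟨y, hy⟩, -, -, hp⟩ := h.reading_of_mem_rds ((hreg r).1 rfl).finishRead_inv.1
    obtain ⟨x, hx⟩ := (hΘ.2.2.1 _ _ _ _ hy).1 d
    exact ⟨hp, .finishRead t r d, x, rfl, trivial, hx⟩
  | orderRead t r =>
    obtain ⟨⟨y, hy⟩, -, -, hp⟩ := h.reading_of_mem_rds ((hreg r).1 rfl).orderRead_inv.1
    obtain ⟨x, hx⟩ := (hΘ.2.2.1 _ _ _ _ hy).1 (s.rg r).stor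
    exact ⟨hp, .finishRead t r (s.rg r).stor, x, rfl, trivial, hx⟩
  | finishWrite t r =>
    obtain ⟨⟨d, y, hy⟩, -, -, hp⟩ := h.writing_of_mem_wrts ((hreg r).1 rfl).finishWrite_inv.1
    obtain ⟨x, hx⟩ := (hΘ.2.2.2.1 _ _ _ _ _ hy).1
    exact ⟨hp, .finishWrite t r, x, rfl, trivial, hx⟩
  | orderWrite t r =>
    obtain ⟨⟨d, y, hy⟩, -, -, hp⟩ := h.writing_of_mem_wrts ((hreg r).1 rfl).orderWrite_inv.1
    obtain ⟨x, hx⟩ := (hΘ.2.2.2.1 _ _ _ _ _ hy).1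
    exact ⟨hp, .finishWrite t r, x, rfl, trivial, hx⟩
  | _ => exact absurd hfin (by simp [RWAct.IsFinish, RWAct.isThreadAct])

/-- Characterisation of justness by thread-enabled actions and occurrences. Responses that a
thread enables without ever acting are exempt, since no register ever offers them. -/
theorem justPath_iff_threadEnabled {Θ : ThreadSys T R D} (hΘ : Θ.Good) {d0 : ∀ r, D r}
    {π : RawPath (MState Θ) (RWAct T R D)}
    (hπ : IsPathOf (MTrans OverlapMode.FR Θ) (Minit Θ d0) π)
    {conc : RWAct T R D → RWAct T R D → Prop}
    (hself : ∀ a b, a.thr = b.thr → ¬ conc a b)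
    (hstart : ∀ a b, ¬ conc a b → a.thr = b.thr ∨ ∃ r, RWAct.inStart r a) :
    JustPath (MTrans OverlapMode.FR Θ) conc Blk π ↔
      ∀ a ∉ (Blk : Set (RWAct T R D)), ThreadEnabled Θ π a →
        (a.IsFinish ∧ NeverActs π a.thr) ∨ (occIndices π fun b => ¬ conc a b).Infinite := by
  constructor
  · rintro hjust a haB ⟨k, hk, hne, x, hx⟩
    by_cases hfin : a.IsFinish
    · refine Or.inl ⟨hfin, fun j hj hjt => ?_⟩
      have hacted : ∃ i < k, (π.acts i).thr = a.thr :=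
        ⟨j, not_le.1 fun hkj => hne j hkj hj hjt, hjt⟩
      obtain ⟨b, hbt, hbB, hbst, hb⟩ :=
        (hπ.threadPhase hΘ a.thr k hk).exists_enabledIn_of_isFinish hΘ hacted hx hfin
      obtain ⟨i, hki, hi, hc⟩ := hjust k b hk hbB hb
      rcases hstart _ _ hc with heq | ⟨r, hr⟩
      · exact hne i hki hi (heq.symm.trans hbt)
      · exact hbst r hr
    · have key : ∀ m : ℕ, k ≤ m → (m : ℕ∞) ≤ π.len →
          ∃ j : ℕ, m ≤ j ∧ (j : ℕ∞) < π.len ∧ ¬ conc a (π.acts j) := fun m hkm hm =>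
        hjust m a hm haB <| (hπ.threadPhase hΘ a.thr m hm).enabledIn_of_tr hΘ (x := x)
          (by rwa [hπ.th_eq_of_forall_thr_ne hne hkm hm]) hfin
      refine Or.inr (Set.infinite_of_forall_exists_gt fun N => ?_)
      rcases le_or_gt ((max k (N + 1) : ℕ) : ℕ∞) π.len with hle | hlt
      · obtain ⟨j, hj, hjl, hc⟩ := key _ (le_max_left _ _) hle
        exact ⟨j, ⟨hjl, hc⟩, lt_of_lt_of_le N.lt_succ_self ((le_max_right _ _).trans hj)⟩
      · obtain ⟨n, hn⟩ := ENat.ne_top_iff_exists.1 hlt.ne_top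
        obtain ⟨j, hj, hjl, -⟩ := key n (by rw [← hn] at hk; exact_mod_cast hk) hn.le
        rw [← hn] at hjl
        exact absurd hj (not_le.2 (by exact_mod_cast hjl))
  · intro h k a hk haB ha
    by_cases hne : ∀ j : ℕ, k ≤ j → (j : ℕ∞) < π.len → (π.acts j).thr ≠ a.thr
    · by_cases hfin : a.IsFinish ∨ ¬ a.isThreadAct
      · exfalso
        obtain ⟨⟨i, hik, hit⟩, b, x, hbt, hbfin, hbx⟩ :=
          (hπ.threadPhase hΘ a.thr k hk).acted_of_enabledIn hΘ ha hfin
        have hilen : (i : ℕ∞) < π.len := lt_of_lt_of_le (by exact_mod_cast hik) hk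
        have hbB : b ∉ (Blk : Set (RWAct T R D)) := by
          rintro ⟨t, rfl⟩
          exact hbfin
        have hbTE : ThreadEnabled Θ π b := by
          refine ⟨k, hk, ?_, ?_⟩
          · rwa [hbt]
          · rw [hbt]
            exact ⟨x, hbx⟩
        rcases h b hbB hbTE with ⟨-, hnever⟩ | hinf
        · exact hnever i hilen (hit.trans hbt.symm)
        · obtain ⟨j, ⟨hjl, hc⟩, hkj⟩ := hinf.exists_gt k
          rcases hstart _ _ hc with heq | ⟨r, hr⟩
          · exact hne j hkj.le hjl (heq.symm.trans hbt)
          · cases b <;> first | exact hbfin | exact hr.elim id id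
      · push Not at hfin
        have hTE : ThreadEnabled Θ π a := by
          obtain ⟨s', hs'⟩ := ha
          exact ⟨k, hk, hne, _, (hs'.1 a.thr).1 ⟨rfl, hfin.2⟩⟩
        rcases h a haB hTE with ⟨hf, -⟩ | hinf
        · exact absurd hf hfin.1
        · obtain ⟨j, ⟨hjl, hc⟩, hkj⟩ := hinf.exists_gt k
          exact ⟨j, hkj.le, hjl, hc⟩
    · push Not at hne
      obtain ⟨j, hkj, hj, heq⟩ := hne
      exact ⟨j, hkj, hj, hself _ _ heq.symm⟩

end Determination

/-- Whether a path of a thread-register model is `B`-`⌣_C`-just (`C ∈ {T,S,I,A}`) is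
completely determined by its set of thread-enabled actions together with its
occurrence-count function: two paths with the same thread-enabled actions and the same
occurrence counts are just for the same concurrency relations. -/
theorem justness_determined_by_threadEnabled_and_occ
    {T R : Type} {D : R → Type} [DecidableEq T]
    (Θ : ThreadSys T R D) (hΘ : Θ.Good) (d0 : ∀ r, D r)
    (π π' : RawPath (MState Θ) (RWAct T R D))
    (hπ : IsPathOf (MTrans OverlapMode.FR Θ) (Minit Θ d0) π)
    (hπ' : IsPathOf (MTrans OverlapMode.FR Θ) (Minit Θ d0) π')
    (conc : RWAct T R D → RWAct T R D → Prop)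
    (hconc : conc = concT ∨ conc = concS ∨ conc = concI ∨ conc = concA)
    (hTE : ∀ a : RWAct T R D, ThreadEnabled Θ π a ↔ ThreadEnabled Θ π' a)
    (hocc : ∀ a : RWAct T R D, occCount π a = occCount π' a) :
    (JustPath (MTrans OverlapMode.FR Θ) conc Blk π ↔
     JustPath (MTrans OverlapMode.FR Θ) conc Blk π') := by
  have hself : ∀ a b : RWAct T R D, a.thr = b.thr → ¬ conc a b := by
    rcases hconc with rfl | rfl | rfl | rfl <;> intro a b hab
    · exact fun h => h hab
    · exact fun h => h.1 hab
    · exact fun h => h.1.1 hab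
    · exact fun h => h.1.1.1 hab
  have hstart : ∀ a b : RWAct T R D, ¬ conc a b → a.thr = b.thr ∨ ∃ r, RWAct.inStart r a := by
    intro a b hab
    by_contra! hno
    obtain ⟨hne, hst⟩ := hno
    have hS : concS a b := ⟨hne, fun ⟨r, hr, _⟩ => hst r hr⟩
    have hI : concI a b := ⟨hS, fun ⟨r, hr, _⟩ => hst r (Or.inr hr)⟩
    have hA : concA a b := ⟨hI, fun ⟨r, hr, _⟩ => hst r (Or.inl hr)⟩
    rcases hconc with rfl | rfl | rfl | rfl
    exacts [hab hne, hab hS, hab hI, hab hA]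
  rw [justPath_iff_threadEnabled hΘ hπ hself hstart,
    justPath_iff_threadEnabled hΘ hπ' hself hstart]
  refine forall₂_congr fun a _ => imp_congr (hTE a) (or_congr (and_congr_right fun _ => ?_) ?_)
  · exact ⟨neverActs_of_occCount_eq hocc, neverActs_of_occCount_eq fun a => (hocc a).symm⟩
  · exact occIndices_infinite_congr hocc _
end

section
/- For each C ∈ {A, I, S}, the restricted model M_C and the full-read atomic model M_FR are weak completed trace equivalent with respect to C-completeness: WCT_C(M_C) = WCT_C(M_FR), where the weak C-complete traces of a model are the sequences ℓ⁻(π) of crit and noncrit actions along C-complete paths from the initial state. -/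
section Runs

variable {S A : Type*}

/-- A step of an LTS that may also idle, the latter labelled `none`. -/
def OptStep (Tr : S → A → S → Prop) (s : S) : Option A → S → Prop
  | none, s' => s' = s
  | some a, s' => Tr s a s'

/-- `σ`, `α` is an infinite, possibly stuttering, run of the LTS `Tr` from `s0`. -/
def IsRun (Tr : S → A → S → Prop) (s0 : S) (σ : ℕ → S) (α : ℕ → Option A) : Prop :=
  σ 0 = s0 ∧ ∀ n, OptStep Tr (σ n) (α n) (σ (n + 1))

/-- Justness for stuttering runs. -/
def JustRun (Tr : S → A → S → Prop) (conc : A → A → Prop) (B : Set A)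
    (σ : ℕ → S) (α : ℕ → Option A) : Prop :=
  ∀ n a, a ∉ B → EnabledIn Tr a (σ n) → ∃ j, n ≤ j ∧ ∃ b, α j = some b ∧ ¬ conc a b

/-- `w` is the weak trace of the action sequence of a stuttering run. -/
def RunTrace (vis : A → Prop) (α : ℕ → Option A) (w : ℕ → Option A) : Prop :=
  ∃ (m : ℕ∞) (f : ℕ → ℕ),
    (∀ i j : ℕ, (i : ℕ∞) < m → (j : ℕ∞) < m → i < j → f i < f j) ∧
    (∀ i : ℕ, (i : ℕ∞) < m → ∃ a, α (f i) = some a ∧ vis a ∧ w i = some a) ∧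
    (∀ i : ℕ, ¬ (i : ℕ∞) < m → w i = none) ∧
    (∀ j a, α j = some a → vis a → ∃ i : ℕ, (i : ℕ∞) < m ∧ f i = j)

theorem exists_run_of_mem_WCT {Tr : S → A → S → Prop} {s0 : S} {conc : A → A → Prop}
    {B : Set A} {vis : A → Prop} {w : ℕ → Option A}
    (h : w ∈ WCT Tr s0 (JustPath Tr conc B) vis) :
    ∃ σ α, IsRun Tr s0 σ α ∧ JustRun Tr conc B σ α ∧ RunTrace vis α w := by
  classical
  obtain ⟨π, ⟨h0, hstep⟩, hjust, m, f, hf, hfi, hn, hall⟩ := h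
  have hfin : ∀ n : ℕ, ¬ (n : ℕ∞) < π.len → ((π.len.toNat : ℕ) : ℕ∞) = π.len := by
    intro n hn
    exact ENat.natCast_toNat fun h => hn (h ▸ ENat.natCast_lt_top n)
  refine ⟨fun n => if (n : ℕ∞) ≤ π.len then π.states n else π.states π.len.toNat,
    fun n => if (n : ℕ∞) < π.len then some (π.acts n) else none, ⟨by simpa using h0, ?_⟩,
    ?_, m, f, hf, ?_, hn, ?_⟩
  · intro n
    by_cases hlt : (n : ℕ∞) < π.len
    · have hle : ((n + 1 : ℕ) : ℕ∞) ≤ π.len := by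
        exact_mod_cast Order.add_one_le_of_lt hlt
      simp only [hlt, hlt.le, hle, if_true]
      exact hstep n hlt
    · have hlen := hfin n hlt
      rw [← hlen] at hlt ⊢
      simp only [Nat.cast_lt, not_lt, Nat.cast_le] at hlt ⊢
      have hnot : ¬ n + 1 ≤ π.len.toNat := by omega
      rw [if_neg (not_lt.2 hlt), if_neg hnot]
      by_cases hle : n ≤ π.len.toNat
      · have : n = π.len.toNat := by omega
        simp [OptStep, ← this]
      · rw [if_neg hle]
        rfl
  · intro n a ha hen
    by_cases hle : (n : ℕ∞) ≤ π.len
    · simp only [hle, if_true] at hen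
      obtain ⟨j, hj, hjl, hc⟩ := hjust n a hle ha hen
      exact ⟨j, hj, _, by simp [hjl], hc⟩
    · simp only [hle, if_false] at hen
      have hlen := hfin n (fun h => hle h.le)
      obtain ⟨j, hj, hjl, hc⟩ := hjust _ a hlen.le ha hen
      rw [← hlen] at hjl
      exact absurd (Nat.cast_lt.1 hjl) (by omega)
  · intro i hi
    obtain ⟨h1, h2, h3⟩ := hfi i hi
    exact ⟨_, by simp [h1], h2, h3⟩
  · intro j a hj hv
    by_cases hlt : (j : ℕ∞) < π.len
    · simp only [hlt, if_true, Option.some.injEq] at hj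
      exact hall j hlt (hj ▸ hv)
    · simp [hlt] at hj

theorem mem_WCT_of_run [Nonempty A] {Tr : S → A → S → Prop} {s0 : S} {conc : A → A → Prop}
    {B : Set A} {vis : A → Prop} {w : ℕ → Option A} {σ : ℕ → S} {α : ℕ → Option A}
    (hrun : IsRun Tr s0 σ α) (hjust : JustRun Tr conc B σ α) (htr : RunTrace vis α w) :
    w ∈ WCT Tr s0 (JustPath Tr conc B) vis := by
  classical
  obtain ⟨a₀⟩ := ‹Nonempty A›
  set P : ℕ → Prop := fun p => (α p).isSome with hP
  set e : ℕ → ℕ := fun q => Nat.casesOn q 0 fun q' => Nat.nth P q' + 1 with he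
  have hcard : ∀ q : ℕ, (q : ℕ∞) < Set.encard {p | P p} ↔
      ∀ hf : {p | P p}.Finite, q < hf.toFinset.card := by
    intro q
    constructor
    · intro h hf
      rw [hf.encard_eq_coe_toFinset_card] at h
      exact_mod_cast h
    · intro h
      by_cases hf : {p | P p}.Finite
      · rw [hf.encard_eq_coe_toFinset_card]
        exact_mod_cast h hf
      · rw [Set.Infinite.encard_eq hf]
        exact ENat.natCast_lt_top q
  have hmem : ∀ q : ℕ, (q : ℕ∞) < Set.encard {p | P p} → P (Nat.nth P q) := fun q hq =>
    Nat.nth_mem q ((hcard q).1 hq)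
  have hcount : ∀ q : ℕ, (q : ℕ∞) < Set.encard {p | P p} → Nat.count P (Nat.nth P q) = q :=
    fun q hq => Nat.count_nth ((hcard q).1 hq)
  have hlt : ∀ p, P p → (Nat.count P p : ℕ∞) < Set.encard {p | P p} := fun p hp =>
    (hcard _).2 fun hf => Nat.count_lt_card hf hp
  have hle_count : ∀ q p : ℕ, (q : ℕ∞) ≤ Set.encard {p | P p} → e q ≤ p →
      q ≤ Nat.count P p := by
    intro q p hq hp
    cases q with
    | zero => exact Nat.zero_le _
    | succ q =>
      have hq' : (q : ℕ∞) < Set.encard {p | P p} :=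
        lt_of_lt_of_le (by exact_mod_cast Nat.lt_succ_self q) hq
      have := Nat.count_strict_mono (hmem q hq') (show Nat.nth P q < p from hp)
      rw [hcount q hq'] at this
      exact this
  have hidle : ∀ q : ℕ, (q : ℕ∞) < Set.encard {p | P p} → σ (Nat.nth P q) = σ (e q) := by
    intro q hq
    have hle : e q ≤ Nat.nth P q := by
      cases q with
      | zero => exact Nat.zero_le _
      | succ q =>
        exact Nat.nth_lt_nth' (Nat.lt_succ_self q) ((hcard _).1 hq)
    have key : ∀ p, e q ≤ p → p ≤ Nat.nth P q → σ p = σ (e q) := by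
      intro p hp
      induction p, hp using Nat.le_induction with
      | base => intro _; rfl
      | succ p hp ih =>
        intro hpq
        have hnP : ¬ P p := by
          intro hPp
          have h1 := Nat.count_strict_mono hPp (Nat.lt_of_succ_le hpq)
          rw [hcount q hq] at h1
          exact absurd (hle_count q p hq.le hp) (by omega)
        have hstep := hrun.2 p
        have hnone : α p = none := by simpa [hP] using hnP
        rw [hnone] at hstep
        rw [show σ (p + 1) = σ p from hstep, ih (by omega)]
    exact key _ hle le_rfl
  have hacts : ∀ q : ℕ, (q : ℕ∞) < Set.encard {p | P p} →
      α (Nat.nth P q) = some ((α (Nat.nth P q)).getD a₀) := by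
    intro q hq
    obtain ⟨b, hb⟩ := Option.isSome_iff_exists.1 (hmem q hq)
    simp [hb]
  have hat : ∀ p b, α p = some b → (α (Nat.nth P (Nat.count P p))).getD a₀ = b := by
    intro p b hb
    rw [Nat.nth_count (show P p by simp [hP, hb]), hb, Option.getD_some]
  have hsome : ∀ p b, α p = some b → P p := fun p b hb => by simp [hP, hb]
  refine ⟨⟨fun q => σ (e q), fun q => (α (Nat.nth P q)).getD a₀, Set.encard {p | P p}⟩,
    ⟨hrun.1, ?_⟩, ?_, ?_⟩
  · intro q hq
    have hstep := hrun.2 (Nat.nth P q)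
    rw [hacts q hq, hidle q hq] at hstep
    exact hstep
  · intro k a hk ha hen
    obtain ⟨j, hj, b, hb, hc⟩ := hjust (e k) a ha hen
    refine ⟨Nat.count P j, hle_count k j hk hj, hlt j (hsome j b hb), ?_⟩
    simpa only [hat j b hb] using hc
  · obtain ⟨m, f, hf, hfi, hn, hall⟩ := htr
    refine ⟨m, fun i => Nat.count P (f i), ?_, ?_, hn, ?_⟩
    · intro i j hi hj hij
      obtain ⟨a, ha, -⟩ := hfi i hi
      exact Nat.count_strict_mono (hsome _ a ha) (hf i j hi hj hij)
    · intro i hi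
      obtain ⟨a, ha, hv, hw⟩ := hfi i hi
      simp only [hat _ a ha]
      exact ⟨hlt _ (hsome _ a ha), hv, hw⟩
    · intro q hq hv
      obtain ⟨i, hi, hfi'⟩ := hall _ _ (hacts q hq) hv
      exact ⟨i, hi, by simp only [hfi', hcount q hq]⟩

end Runs

section Model

set_option linter.unusedSectionVars false

variable {T R : Type} {D : R → Type} [DecidableEq T] {Θ : ThreadSys T R D}
variable {mode cm : OverlapMode} {s s' : MState Θ} {a : RWAct T R D}

/-- Start actions and thread-local actions: what a thread may do outside operations. -/
def RWAct.Initiates : RWAct T R D → Prop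
  | startRead _ _ => True
  | startWrite _ _ _ => True
  | crit _ => True
  | noncrit _ => True
  | tloc _ _ => True
  | _ => False

theorem RWAct.Initiates.isThreadAct (h : a.Initiates) : a.isThreadAct := by
  cases a <;> simp_all [Initiates, RWAct.isThreadAct]

namespace AtoTrans

variable {r : R} {g g' : RegState T (D r)} {t : T}

theorem startRead_iff : AtoTrans mode r g (.startRead t r) g' ↔
    gRead mode g t ∧ g' = { g with rds := insert t g.rds, pend := insert t g.pend } := by
  constructor
  · intro h
    cases h with
    | startRead _ h => exact ⟨h, rfl⟩
  · rintro ⟨h, rfl⟩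
    exact .startRead g t h

theorem orderRead_iff : AtoTrans mode r g (.orderRead t r) g' ↔
    t ∈ g.rds ∧ t ∈ g.pend ∧
      g' = { g with pend := g.pend \ {t}, recv := Function.update g.recv t g.stor } := by
  constructor
  · intro h
    cases h with
    | orderRead _ h1 h2 => exact ⟨h1, h2, rfl⟩
  · rintro ⟨h1, h2, rfl⟩
    exact .orderRead g t h1 h2

theorem finishRead_iff {d : D r} : AtoTrans mode r g (.finishRead t r d) g' ↔
    t ∈ g.rds ∧ t ∉ g.pend ∧ d = g.recv t ∧ g' = { g with rds := g.rds \ {t} } := by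
  constructor
  · intro h
    cases h with
    | finishRead _ h1 h2 => exact ⟨h1, h2, rfl, rfl⟩
  · rintro ⟨h1, h2, rfl, rfl⟩
    exact .finishRead g t h1 h2

theorem startWrite_iff {d : D r} : AtoTrans mode r g (.startWrite t r d) g' ↔
    gWrite mode g t ∧ g' = { g with wrts := insert t g.wrts, pend := insert t g.pend,
                                    recv := Function.update g.recv t d } := by
  constructor
  · intro h
    cases h with
    | startWrite _ _ h => exact ⟨h, rfl⟩
  · rintro ⟨h, rfl⟩
    exact .startWrite g t d h

theorem orderWrite_iff : AtoTrans mode r g (.orderWrite t r) g' ↔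
    t ∈ g.wrts ∧ t ∈ g.pend ∧ g' = { g with pend := g.pend \ {t}, stor := g.recv t } := by
  constructor
  · intro h
    cases h with
    | orderWrite _ h1 h2 => exact ⟨h1, h2, rfl⟩
  · rintro ⟨h1, h2, rfl⟩
    exact .orderWrite g t h1 h2

theorem finishWrite_iff : AtoTrans mode r g (.finishWrite t r) g' ↔
    t ∈ g.wrts ∧ t ∉ g.pend ∧ g' = { g with wrts := g.wrts \ {t} } := by
  constructor
  · intro h
    cases h with
    | finishWrite _ h1 h2 => exact ⟨h1, h2, rfl⟩
  · rintro ⟨h1, h2, rfl⟩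
    exact .finishWrite g t h1 h2

theorem not_read {t : T} {r' : R} {d : D r'} : ¬ AtoTrans mode r g (.read t r' d) g' :=
  fun h => nomatch h

end AtoTrans

namespace MTrans

theorem thread (h : MTrans mode Θ s a s') (ha : a.isThreadAct) :
    Θ.tr a.thr (s.th a.thr) a (s'.th a.thr) :=
  (h.1 a.thr).1 ⟨rfl, ha⟩

theorem reg (h : MTrans mode Θ s a s') {r : R} (hr : a.regOf = some r) :
    AtoTrans mode r (s.rg r) a (s'.rg r) :=
  (h.2 r).1 hr

theorem reg_ne (h : MTrans mode Θ s a s') {r : R} (hr : a.regOf ≠ some r) :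
    s'.rg r = s.rg r :=
  (h.2 r).2 hr

theorem th_ne (h : MTrans mode Θ s a s') {t : T} (ht : a.thr ≠ t) : s'.th t = s.th t :=
  (h.1 t).2 fun h' => ht h'.1

theorem th_of_not_isThreadAct (h : MTrans mode Θ s a s') (ha : ¬ a.isThreadAct) (t : T) :
    s'.th t = s.th t :=
  (h.1 t).2 fun h' => ha h'.2

end MTrans

/-- `s` and `s'` agree on everything that concerns thread `t`. -/
structure SameView (s s' : MState Θ) (t : T) : Prop where
  th : s'.th t = s.th t
  rds : ∀ r, t ∈ (s'.rg r).rds ↔ t ∈ (s.rg r).rds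
  wrts : ∀ r, t ∈ (s'.rg r).wrts ↔ t ∈ (s.rg r).wrts
  pend : ∀ r, t ∈ (s'.rg r).pend ↔ t ∈ (s.rg r).pend
  recv : ∀ r, (s'.rg r).recv t = (s.rg r).recv t

theorem SameView.refl (s : MState Θ) (t : T) : SameView s s t :=
  ⟨rfl, fun _ => .rfl, fun _ => .rfl, fun _ => .rfl, fun _ => rfl⟩

theorem SameView.trans {s s' s'' : MState Θ} {t : T} (h : SameView s s' t)
    (h' : SameView s' s'' t) : SameView s s'' t :=
  ⟨h'.th.trans h.th, fun r => (h'.rds r).trans (h.rds r), fun r => (h'.wrts r).trans (h.wrts r),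
    fun r => (h'.pend r).trans (h.pend r), fun r => (h'.recv r).trans (h.recv r)⟩

theorem MTrans.sameView (h : MTrans mode Θ s a s') {t : T} (ht : a.thr ≠ t) :
    SameView s s' t := by
  have key : ∀ r, (t ∈ (s'.rg r).rds ↔ t ∈ (s.rg r).rds) ∧
      (t ∈ (s'.rg r).wrts ↔ t ∈ (s.rg r).wrts) ∧ (t ∈ (s'.rg r).pend ↔ t ∈ (s.rg r).pend) ∧
      (s'.rg r).recv t = (s.rg r).recv t := by
    intro r
    by_cases hr : a.regOf = some r
    · have h' := h.reg hr
      generalize s.rg r = g at h'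
      generalize s'.rg r = g' at h'
      have ht' := ht.symm
      cases h' <;> simp_all [RWAct.thr]
    · rw [h.reg_ne hr]
      simp
  exact ⟨h.th_ne ht, fun r => (key r).1, fun r => (key r).2.1, fun r => (key r).2.2.1,
    fun r => (key r).2.2.2⟩

/-- Thread `t` is not performing any operation. -/
def Idle (s : MState Θ) (t : T) : Prop := ∀ r, t ∉ (s.rg r).rds ∧ t ∉ (s.rg r).wrts

theorem Idle.of_sameView {t : T} (hi : Idle s t) (h : SameView s s' t) : Idle s' t :=
  fun r => ⟨fun hr => (hi r).1 ((h.rds r).1 hr), fun hr => (hi r).2 ((h.wrts r).1 hr)⟩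

/-- Registers and threads agree about the operations in progress. -/
structure OpInv (s : MState Θ) : Prop where
  rds : ∀ r t, t ∈ (s.rg r).rds → ∃ x, Θ.tr t x (.startRead t r) (s.th t)
  wrts : ∀ r t, t ∈ (s.rg r).wrts → ∃ d x, Θ.tr t x (.startWrite t r d) (s.th t)
  pend : ∀ r t, t ∈ (s.rg r).pend → t ∈ (s.rg r).rds ∨ t ∈ (s.rg r).wrts

theorem opInv_Minit (d0 : ∀ r, D r) : OpInv (Minit Θ d0) := by
  constructor <;> simp [Minit]

namespace OpInv

variable (hs : OpInv s) (hΘ : Θ.Good) {r r' : R} {t : T}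

include hs hΘ

theorem rds_tr (h : t ∈ (s.rg r).rds) {x : Θ.TS t} (htr : Θ.tr t (s.th t) a x) :
    ∃ d, a = .finishRead t r d := by
  obtain ⟨x0, hx⟩ := hs.rds r t h
  exact (hΘ.2.2.1 t r x0 _ hx).2 a x htr

theorem wrts_tr (h : t ∈ (s.rg r).wrts) {x : Θ.TS t} (htr : Θ.tr t (s.th t) a x) :
    a = .finishWrite t r := by
  obtain ⟨d, x0, hx⟩ := hs.wrts r t h
  exact (hΘ.2.2.2.1 t r d x0 _ hx).2 a x htr

theorem exists_finishRead (h : t ∈ (s.rg r).rds) (d : D r) :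
    ∃ x, Θ.tr t (s.th t) (.finishRead t r d) x := by
  obtain ⟨x0, hx⟩ := hs.rds r t h
  exact (hΘ.2.2.1 t r x0 _ hx).1 d

theorem exists_finishWrite (h : t ∈ (s.rg r).wrts) :
    ∃ x, Θ.tr t (s.th t) (.finishWrite t r) x := by
  obtain ⟨d, x0, hx⟩ := hs.wrts r t h
  exact (hΘ.2.2.2.1 t r d x0 _ hx).1

theorem rds_unique (h : t ∈ (s.rg r).rds) (h' : t ∈ (s.rg r').rds) : r' = r := by
  obtain ⟨x, hx⟩ := hs.exists_finishRead hΘ h' (s.rg r').stor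
  obtain ⟨d, hd⟩ := hs.rds_tr hΘ h hx
  injection hd

theorem wrts_unique (h : t ∈ (s.rg r).wrts) (h' : t ∈ (s.rg r').wrts) : r' = r := by
  obtain ⟨x, hx⟩ := hs.exists_finishWrite hΘ h'
  injection hs.wrts_tr hΘ h hx

theorem not_wrts_of_rds (h : t ∈ (s.rg r).rds) : t ∉ (s.rg r').wrts := by
  intro h'
  obtain ⟨x, hx⟩ := hs.exists_finishWrite hΘ h'
  obtain ⟨d, hd⟩ := hs.rds_tr hΘ h hx
  cases hd

theorem idle_of_initiates {x : Θ.TS a.thr} (htr : Θ.tr a.thr (s.th a.thr) a x)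
    (ha : a.Initiates) : Idle s a.thr := by
  intro r
  constructor <;> intro h
  · obtain ⟨d, hd⟩ := hs.rds_tr hΘ h htr
    rw [hd] at ha
    exact ha
  · rw [hs.wrts_tr hΘ h htr] at ha
    exact ha

theorem reading_act (h : t ∈ (s.rg r).rds) (hstep : MTrans mode Θ s a s') (hat : a.thr = t) :
    (a = .orderRead t r ∧ t ∈ (s.rg r).pend) ∨
      (∃ d, a = .finishRead t r d) ∧ t ∉ (s.rg r).pend := by
  subst hat
  by_cases ha : a.isThreadAct
  · obtain ⟨d, hd⟩ := hs.rds_tr hΘ h (hstep.thread ha)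
    refine .inr ⟨⟨d, hd⟩, ?_⟩
    generalize a.thr = t at *
    subst hd
    exact (AtoTrans.finishRead_iff.1 (hstep.reg rfl)).2.1
  · cases a with
    | orderRead t r' =>
      have h' := AtoTrans.orderRead_iff.1 (hstep.reg rfl)
      obtain rfl := hs.rds_unique hΘ h h'.1
      exact .inl ⟨rfl, h'.2.1⟩
    | orderWrite t r' =>
      exact absurd (AtoTrans.orderWrite_iff.1 (hstep.reg rfl)).1 (hs.not_wrts_of_rds hΘ h)
    | _ => exact absurd trivial ha

theorem writing_act (h : t ∈ (s.rg r).wrts) (hstep : MTrans mode Θ s a s') (hat : a.thr = t) :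
    (a = .orderWrite t r ∧ t ∈ (s.rg r).pend) ∨
      a = .finishWrite t r ∧ t ∉ (s.rg r).pend := by
  subst hat
  by_cases ha : a.isThreadAct
  · have hd := hs.wrts_tr hΘ h (hstep.thread ha)
    refine .inr ⟨hd, ?_⟩
    generalize a.thr = t at *
    subst hd
    exact (AtoTrans.finishWrite_iff.1 (hstep.reg rfl)).2.1
  · cases a with
    | orderWrite t r' =>
      have h' := AtoTrans.orderWrite_iff.1 (hstep.reg rfl)
      obtain rfl := hs.wrts_unique hΘ h h'.1
      exact .inl ⟨rfl, h'.2.1⟩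
    | orderRead t r' =>
      exact absurd h (hs.not_wrts_of_rds hΘ (AtoTrans.orderRead_iff.1 (hstep.reg rfl)).1)
    | _ => exact absurd trivial ha

end OpInv

theorem Idle.initiates {t : T} (hi : Idle s t) (hstep : MTrans mode Θ s a s')
    (hat : a.thr = t) : a.Initiates := by
  subst hat
  cases a with
  | orderRead t r => exact (hi r).1 (AtoTrans.orderRead_iff.1 (hstep.reg rfl)).1
  | orderWrite t r => exact (hi r).2 (AtoTrans.orderWrite_iff.1 (hstep.reg rfl)).1
  | finishRead t r d => exact (hi r).1 (AtoTrans.finishRead_iff.1 (hstep.reg rfl)).1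
  | finishWrite t r => exact (hi r).2 (AtoTrans.finishWrite_iff.1 (hstep.reg rfl)).1
  | read t r d => exact absurd (hstep.reg rfl) AtoTrans.not_read
  | _ => trivial

/-- After a response action the thread is idle. -/
theorem OpInv.idle_of_finish (hs : OpInv s) (hΘ : Θ.Good) (hstep : MTrans mode Θ s a s')
    (ha : (∃ t r d, a = .finishRead t r d) ∨ ∃ t r, a = .finishWrite t r) :
    Idle s' a.thr := by
  intro r'
  rcases ha with ⟨t, r, d, rfl⟩ | ⟨t, r, rfl⟩
  · obtain ⟨h1, h2, h3, h4⟩ := AtoTrans.finishRead_iff.1 (hstep.reg rfl)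
    by_cases hr : r = r'
    · subst hr
      rw [h4]
      exact ⟨by simp [RWAct.thr], hs.not_wrts_of_rds hΘ h1⟩
    · rw [hstep.reg_ne (by simpa [RWAct.regOf] using hr)]
      exact ⟨fun h => hr (hs.rds_unique hΘ h h1), hs.not_wrts_of_rds hΘ h1⟩
  · obtain ⟨h1, h2, h4⟩ := AtoTrans.finishWrite_iff.1 (hstep.reg rfl)
    by_cases hr : r = r'
    · subst hr
      rw [h4]
      exact ⟨fun h => hs.not_wrts_of_rds hΘ h h1, by simp [RWAct.thr]⟩
    · rw [hstep.reg_ne (by simpa [RWAct.regOf] using hr)]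
      exact ⟨fun h => hs.not_wrts_of_rds hΘ h h1, fun h => hr (hs.wrts_unique hΘ h h1)⟩

theorem OpInv.step (hs : OpInv s) (hΘ : Θ.Good) (hstep : MTrans mode Θ s a s') :
    OpInv s' := by
  have hpend : ∀ t, Idle s t → ∀ r, t ∉ (s.rg r).pend := fun t hi r h =>
    (hs.pend r t h).elim (hi r).1 (hi r).2
  suffices h : ∀ r t, (t ∈ (s'.rg r).rds → ∃ x, Θ.tr t x (.startRead t r) (s'.th t)) ∧
      (t ∈ (s'.rg r).wrts → ∃ d x, Θ.tr t x (.startWrite t r d) (s'.th t)) ∧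
      (t ∈ (s'.rg r).pend → t ∈ (s'.rg r).rds ∨ t ∈ (s'.rg r).wrts) from
    ⟨fun r t => (h r t).1, fun r t => (h r t).2.1, fun r t => (h r t).2.2⟩
  intro r t
  by_cases hat : a.thr = t
  swap
  · have hv := hstep.sameView hat
    rw [hv.rds, hv.wrts, hv.pend, hv.th]
    exact ⟨hs.rds r t, hs.wrts r t, hs.pend r t⟩
  by_cases hr : a.regOf = some r
  · cases a with
    | startRead t' r' =>
      obtain rfl : r' = r := by simpa [RWAct.regOf] using hr
      obtain rfl : t' = t := hat
      have hi := hs.idle_of_initiates hΘ (hstep.thread trivial) trivial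
      obtain ⟨hg, hg'⟩ := AtoTrans.startRead_iff.1 (hstep.reg rfl)
      rw [hg']
      exact ⟨fun _ => ⟨_, hstep.thread trivial⟩, fun h => absurd h (hi _).2,
        fun _ => .inl (by simp)⟩
    | startWrite t' r' d =>
      obtain rfl : r' = r := by simpa [RWAct.regOf] using hr
      obtain rfl : t' = t := hat
      have hi := hs.idle_of_initiates hΘ (hstep.thread trivial) trivial
      obtain ⟨hg, hg'⟩ := AtoTrans.startWrite_iff.1 (hstep.reg rfl)
      rw [hg']
      exact ⟨fun h => absurd h (hi _).1, fun _ => ⟨d, _, hstep.thread trivial⟩,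
        fun _ => .inr (by simp)⟩
    | orderRead t' r' =>
      obtain rfl : r' = r := by simpa [RWAct.regOf] using hr
      obtain ⟨h1, h2, hg'⟩ := AtoTrans.orderRead_iff.1 (hstep.reg rfl)
      rw [hg', hstep.th_of_not_isThreadAct (fun h => h)]
      exact ⟨hs.rds _ _, hs.wrts _ _, fun h => hs.pend _ _ h.1⟩
    | orderWrite t' r' =>
      obtain rfl : r' = r := by simpa [RWAct.regOf] using hr
      obtain ⟨h1, h2, hg'⟩ := AtoTrans.orderWrite_iff.1 (hstep.reg rfl)
      rw [hg', hstep.th_of_not_isThreadAct (fun h => h)]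
      exact ⟨hs.rds _ _, hs.wrts _ _, fun h => hs.pend _ _ h.1⟩
    | finishRead t' r' d =>
      obtain rfl : r' = r := by simpa [RWAct.regOf] using hr
      obtain rfl : t' = t := hat
      have hi := hs.idle_of_finish hΘ hstep (.inl ⟨_, _, _, rfl⟩)
      obtain ⟨h1, h2, h3, hg'⟩ := AtoTrans.finishRead_iff.1 (hstep.reg rfl)
      refine ⟨fun h => absurd h (hi _).1, fun h => absurd h (hi _).2, ?_⟩
      rw [hg']
      exact fun h => absurd h h2
    | finishWrite t' r' =>
      obtain rfl : r' = r := by simpa [RWAct.regOf] using hr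
      obtain rfl : t' = t := hat
      have hi := hs.idle_of_finish hΘ hstep (.inr ⟨_, _, rfl⟩)
      obtain ⟨h1, h2, hg'⟩ := AtoTrans.finishWrite_iff.1 (hstep.reg rfl)
      refine ⟨fun h => absurd h (hi _).1, fun h => absurd h (hi _).2, ?_⟩
      rw [hg']
      exact fun h => absurd h h2
    | read t' r' d => exact absurd (hstep.reg hr) AtoTrans.not_read
    | _ => cases hr
  · rw [hstep.reg_ne hr]
    by_cases hi : Idle s t
    · exact ⟨fun h => absurd h (hi _).1, fun h => absurd h (hi _).2,
        fun h => absurd h (hpend t hi r)⟩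
    · refine ⟨fun h => ?_, fun h => ?_, hs.pend r t⟩
      · rcases hs.reading_act hΘ h hstep hat with ⟨rfl, -⟩ | ⟨⟨d, rfl⟩, -⟩ <;>
          exact absurd rfl hr
      · rcases hs.writing_act hΘ h hstep hat with ⟨rfl, -⟩ | ⟨rfl, -⟩ <;>
          exact absurd rfl hr

end Model

section RunLemmas

set_option linter.unusedSectionVars false

variable {T R : Type} {D : R → Type} [DecidableEq T] {Θ : ThreadSys T R D}
variable {mode cm : OverlapMode} {s s' : MState Θ} {a b : RWAct T R D}

theorem not_concOf_of_thr_eq (h : a.thr = b.thr) : ¬ concOf cm a b := by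
  cases cm <;> simp [concOf, concA, concI, concS, concT, h]

theorem thr_eq_of_not_concOf_left (ha : ∀ r, ¬ a.inStart r) (h : ¬ concOf cm a b) :
    a.thr = b.thr := by
  have hr : ∀ r, ¬ a.isReadStart r := fun r h => ha r (.inl h)
  have hw : ∀ r, ¬ a.isWriteStart r := fun r h => ha r (.inr h)
  by_contra hne
  exact h (by cases cm <;> simp [concOf, concA, concI, concS, concT, ha, hr, hw, hne])

theorem thr_eq_of_not_concOf_right (hb : ∀ r, ¬ b.inStart r) (h : ¬ concOf cm a b) :
    a.thr = b.thr := by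
  have hr : ∀ r, ¬ b.isReadStart r := fun r h => hb r (.inl h)
  have hw : ∀ r, ¬ b.isWriteStart r := fun r h => hb r (.inr h)
  by_contra hne
  exact h (by cases cm <;> simp [concOf, concA, concI, concS, concT, hr, hw, hne])

theorem MTrans.of_local {x : Θ.TS a.thr} (ha : a.isThreadAct) (hr : a.regOf = none)
    (htr : Θ.tr a.thr (s.th a.thr) a x) :
    MTrans mode Θ s a ⟨Function.update s.th a.thr x, s.rg⟩ := by
  refine ⟨fun t => ⟨?_, fun h => ?_⟩, fun r => ⟨fun h => ?_, fun _ => rfl⟩⟩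
  · rintro ⟨rfl, -⟩
    simpa using htr
  · exact Function.update_of_ne (fun h' => h ⟨h'.symm, ha⟩) _ _
  · rw [hr] at h
    cases h

theorem MTrans.of_register [DecidableEq R] {r : R} {g : RegState T (D r)}
    (ha : ¬ a.isThreadAct) (hr : a.regOf = some r) (hg : AtoTrans mode r (s.rg r) a g) :
    MTrans mode Θ s a ⟨s.th, Function.update s.rg r g⟩ := by
  refine ⟨fun t => ⟨fun h => absurd h.2 ha, fun _ => rfl⟩, fun r' => ⟨fun h => ?_, fun h => ?_⟩⟩
  · obtain rfl : r = r' := Option.some.inj (hr.symm.trans h)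
    simpa using hg
  · exact Function.update_of_ne (fun h' : r' = r => h (h' ▸ hr)) _ _

theorem MTrans.of_sync [DecidableEq R] {r : R} {g : RegState T (D r)} {x : Θ.TS a.thr}
    (ha : a.isThreadAct) (hr : a.regOf = some r) (htr : Θ.tr a.thr (s.th a.thr) a x)
    (hg : AtoTrans mode r (s.rg r) a g) :
    MTrans mode Θ s a ⟨Function.update s.th a.thr x, Function.update s.rg r g⟩ := by
  refine ⟨fun t => ⟨?_, fun h => ?_⟩, fun r' => ⟨fun h => ?_, fun h => ?_⟩⟩
  · rintro ⟨rfl, -⟩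
    simpa using htr
  · exact Function.update_of_ne (fun h' => h ⟨h'.symm, ha⟩) _ _
  · obtain rfl : r = r' := Option.some.inj (hr.symm.trans h)
    simpa using hg
  · exact Function.update_of_ne (fun h' : r' = r => h (h' ▸ hr)) _ _

/-- A thread performing an operation can always proceed, and only its own actions interfere. -/
theorem OpInv.exists_enabled (hs : OpInv s) (hΘ : Θ.Good) {t : T} (ht : ¬ Idle s t) :
    ∃ a : RWAct T R D, a.thr = t ∧ a ∉ Blk (T := T) (R := R) (D := D) ∧
      (∀ r, ¬ a.inStart r) ∧ EnabledIn (MTrans mode Θ) a s := by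
  classical
  simp only [Idle, not_forall, not_and_or, not_not] at ht
  obtain ⟨r, h | h⟩ := ht <;> by_cases hp : t ∈ (s.rg r).pend
  · exact ⟨.orderRead t r, rfl, by simp [Blk], fun _ h => h.elim id id,
      _, MTrans.of_register (fun h => h) rfl (.orderRead _ t h hp)⟩
  · obtain ⟨x, hx⟩ := hs.exists_finishRead hΘ h ((s.rg r).recv t)
    exact ⟨.finishRead t r ((s.rg r).recv t), rfl, by simp [Blk], fun _ h => h.elim id id,
      _, MTrans.of_sync trivial rfl hx (.finishRead _ t h hp)⟩
  · exact ⟨.orderWrite t r, rfl, by simp [Blk], fun _ h => h.elim id id,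
      _, MTrans.of_register (fun h => h) rfl (.orderWrite _ t h hp)⟩
  · obtain ⟨x, hx⟩ := hs.exists_finishWrite hΘ h
    exact ⟨.finishWrite t r, rfl, by simp [Blk], fun _ h => h.elim id id,
      _, MTrans.of_sync trivial rfl hx (.finishWrite _ t h hp)⟩

variable {σ : ℕ → MState Θ} {α : ℕ → Option (RWAct T R D)} {d0 : ∀ r, D r} {t : T} {r : R}

/-- Thread `t` does not act in the interval `[n, j)`. -/
def Silent (α : ℕ → Option (RWAct T R D)) (t : T) (n j : ℕ) : Prop :=
  ∀ i, n ≤ i → i < j → ∀ b, α i = some b → b.thr ≠ t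

theorem IsRun.step {S A : Type*} {Tr : S → A → S → Prop} {s0 : S} {σ : ℕ → S}
    {α : ℕ → Option A} (hrun : IsRun Tr s0 σ α) {n : ℕ} {a : A} (h : α n = some a) :
    Tr (σ n) a (σ (n + 1)) := by
  have := hrun.2 n
  rw [h] at this
  exact this

theorem IsRun.idle {S A : Type*} {Tr : S → A → S → Prop} {s0 : S} {σ : ℕ → S}
    {α : ℕ → Option A} (hrun : IsRun Tr s0 σ α) {n : ℕ} (h : α n = none) :
    σ (n + 1) = σ n := by
  have := hrun.2 n
  rw [h] at this
  exact this

section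

variable (hrun : IsRun (MTrans mode Θ) (Minit Θ d0) σ α)

include hrun

theorem opInv_run (hΘ : Θ.Good) (n : ℕ) : OpInv (σ n) := by
  induction n with
  | zero =>
    rw [hrun.1]
    exact opInv_Minit d0
  | succ n ih =>
    cases h : α n with
    | none => exact hrun.idle h ▸ ih
    | some a => exact ih.step hΘ (hrun.step h)

theorem sameView_succ {n : ℕ} (h : ∀ b, α n = some b → b.thr ≠ t) :
    SameView (σ n) (σ (n + 1)) t := by
  cases hn : α n with
  | none =>
    rw [hrun.idle hn]
    exact .refl _ _
  | some a => exact (hrun.step hn).sameView (h a hn)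

theorem Silent.sameView {n j : ℕ} (hnj : n ≤ j) (h : Silent α t n j) :
    SameView (σ n) (σ j) t := by
  induction j, hnj using Nat.le_induction with
  | base => exact .refl _ _
  | succ j hj ih =>
    exact (ih fun i h1 h2 => h i h1 (by omega)).trans
      (sameView_succ hrun (h j hj (by omega)))

/-- The first later action of a thread that acts again. -/
theorem exists_first_act {n j : ℕ} (hnj : n ≤ j) (hb : α j = some b) (ht : b.thr = t) :
    ∃ i c, n ≤ i ∧ i ≤ j ∧ α i = some c ∧ c.thr = t ∧ Silent α t n i ∧
      SameView (σ n) (σ i) t := by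
  classical
  have hex : ∃ i, n ≤ i ∧ ∃ c, α i = some c ∧ c.thr = t := ⟨j, hnj, b, hb, ht⟩
  obtain ⟨h1, c, h2, h3⟩ := Nat.find_spec hex
  have hsil : Silent α t n (Nat.find hex) := fun i hi hlt c hc hct =>
    Nat.find_min hex hlt ⟨hi, c, hc, hct⟩
  exact ⟨_, c, h1, Nat.find_min' hex ⟨hnj, b, hb, ht⟩, h2, h3, hsil, hsil.sameView hrun h1⟩

variable (hΘ : Θ.Good) (hjust : JustRun (MTrans mode Θ) (concOf cm) Blk σ α)

include hΘ hjust

theorem exists_next_act {n : ℕ} (hni : ¬ Idle (σ n) t) :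
    ∃ i c, n ≤ i ∧ α i = some c ∧ c.thr = t ∧ Silent α t n i ∧ SameView (σ n) (σ i) t := by
  obtain ⟨a, hat, haB, has, hen⟩ := (opInv_run hrun hΘ n).exists_enabled hΘ (mode := mode) hni
  obtain ⟨j, hj, b, hb, hc⟩ := hjust n a haB hen
  obtain ⟨i, c, h1, -, h2, h3, h4, h5⟩ := exists_first_act hrun hj hb
    ((thr_eq_of_not_concOf_left has hc).symm.trans hat)
  exact ⟨i, c, h1, h2, h3, h4, h5⟩

theorem exists_orderRead {n : ℕ} (hr : t ∈ ((σ n).rg r).rds) (hp : t ∈ ((σ n).rg r).pend) :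
    ∃ j, n ≤ j ∧ α j = some (.orderRead t r) := by
  obtain ⟨i, c, h1, h2, h3, -, hv⟩ := exists_next_act hrun hΘ hjust fun h => (h r).1 hr
  rcases (opInv_run hrun hΘ i).reading_act hΘ ((hv.rds r).2 hr) (hrun.step h2) h3 with
    ⟨rfl, -⟩ | ⟨-, h⟩
  · exact ⟨i, h1, h2⟩
  · exact absurd ((hv.pend r).2 hp) h

theorem exists_orderWrite {n : ℕ} (hr : t ∈ ((σ n).rg r).wrts)
    (hp : t ∈ ((σ n).rg r).pend) :
    ∃ j, n ≤ j ∧ α j = some (.orderWrite t r) ∧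
      ((σ j).rg r).recv t = ((σ n).rg r).recv t := by
  obtain ⟨i, c, h1, h2, h3, -, hv⟩ := exists_next_act hrun hΘ hjust fun h => (h r).2 hr
  rcases (opInv_run hrun hΘ i).writing_act hΘ ((hv.wrts r).2 hr) (hrun.step h2) h3 with
    ⟨rfl, -⟩ | ⟨-, h⟩
  · exact ⟨i, h1, h2, hv.recv r⟩
  · exact absurd ((hv.pend r).2 hp) h

/-- A thread whose operation has been ordered next performs the response and is then idle. -/
theorem exists_finish {n : ℕ} (hr : t ∈ ((σ n).rg r).rds ∨ t ∈ ((σ n).rg r).wrts)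
    (hp : t ∉ ((σ n).rg r).pend) :
    ∃ j b, n ≤ j ∧ α j = some b ∧ b.thr = t ∧ Silent α t n j ∧ SameView (σ n) (σ j) t ∧
      ((t ∈ ((σ n).rg r).rds ∧ b = .finishRead t r (((σ n).rg r).recv t)) ∨
        (t ∈ ((σ n).rg r).wrts ∧ b = .finishWrite t r)) ∧ Idle (σ (j + 1)) t := by
  obtain ⟨i, c, h1, h2, h3, h4, hv⟩ := exists_next_act hrun hΘ hjust
    fun h => hr.elim (h r).1 (h r).2
  have hI := opInv_run hrun hΘ i
  have hstep := hrun.step h2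
  refine ⟨i, c, h1, h2, h3, h4, hv, ?_⟩
  rcases hr with hr | hr
  · rcases hI.reading_act hΘ ((hv.rds r).2 hr) hstep h3 with ⟨-, h⟩ | ⟨⟨d, rfl⟩, -⟩
    · exact absurd ((hv.pend r).1 h) hp
    · have hd := (AtoTrans.finishRead_iff.1 (hstep.reg rfl)).2.2.1
      rw [hv.recv r] at hd
      exact ⟨.inl ⟨hr, by rw [hd]⟩, hI.idle_of_finish hΘ hstep (.inl ⟨_, _, _, rfl⟩)⟩
  · rcases hI.writing_act hΘ ((hv.wrts r).2 hr) hstep h3 with ⟨-, h⟩ | ⟨rfl, -⟩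
    · exact absurd ((hv.pend r).1 h) hp
    · exact ⟨.inr ⟨hr, rfl⟩, hI.idle_of_finish hΘ hstep (.inr ⟨_, _, rfl⟩)⟩

theorem exists_idle (n : ℕ) : ∃ k, n ≤ k ∧ Idle (σ k) t := by
  by_cases hi : Idle (σ n) t
  · exact ⟨n, le_rfl, hi⟩
  simp only [Idle, not_forall, not_and_or, not_not] at hi
  obtain ⟨r, hr⟩ := hi
  have hdone : ∀ m, n ≤ m → (t ∈ ((σ m).rg r).rds ∨ t ∈ ((σ m).rg r).wrts) →
      t ∉ ((σ m).rg r).pend → ∃ k, n ≤ k ∧ Idle (σ k) t := by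
    intro m hm h hp
    obtain ⟨j, b, hj, -, -, -, -, -, hidle⟩ := exists_finish hrun hΘ hjust h hp
    exact ⟨j + 1, by omega, hidle⟩
  by_cases hp : t ∈ ((σ n).rg r).pend
  · rcases hr with hr | hr
    · obtain ⟨j, hj, hb⟩ := exists_orderRead hrun hΘ hjust hr hp
      obtain ⟨h1, h2, h3⟩ := AtoTrans.orderRead_iff.1 ((hrun.step hb).reg rfl)
      exact hdone (j + 1) (by omega) (by rw [h3]; exact .inl h1) (by rw [h3]; simp)
    · obtain ⟨j, hj, hb, -⟩ := exists_orderWrite hrun hΘ hjust hr hp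
      obtain ⟨h1, h2, h3⟩ := AtoTrans.orderWrite_iff.1 ((hrun.step hb).reg rfl)
      exact hdone (j + 1) (by omega) (by rw [h3]; exact .inr h1) (by rw [h3]; simp)
  · exact hdone n le_rfl hr hp

end

end RunLemmas

section RestrictedToFull

set_option linter.unusedSectionVars false

variable {T R : Type} {D : R → Type} [DecidableEq T] {Θ : ThreadSys T R D}
variable {mode mode' : OverlapMode} {s s' : MState Θ} {a b : RWAct T R D}

theorem AtoTrans.change_mode {r : R} {g g' : RegState T (D r)} (h : AtoTrans mode r g a g')
    (hR : ∀ t, a = .startRead t r → gRead mode' g t)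
    (hW : ∀ t d, a = .startWrite t r d → gWrite mode' g t) : AtoTrans mode' r g a g' := by
  cases h with
  | startRead t h => exact .startRead _ t (hR t rfl)
  | startWrite t d h => exact .startWrite _ t d (hW t d rfl)
  | orderRead t h1 h2 => exact .orderRead _ t h1 h2
  | orderWrite t h1 h2 => exact .orderWrite _ t h1 h2
  | finishRead t h1 h2 => exact .finishRead _ t h1 h2
  | finishWrite t h1 h2 => exact .finishWrite _ t h1 h2

theorem MTrans.change_mode (h : MTrans mode Θ s a s')
    (hR : ∀ t r, a = .startRead t r → gRead mode' (s.rg r) t)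
    (hW : ∀ t r d, a = .startWrite t r d → gWrite mode' (s.rg r) t) : MTrans mode' Θ s a s' :=
  ⟨h.1, fun r => ⟨fun hr => (h.reg hr).change_mode (fun t => hR t r) fun t => hW t r,
    h.reg_ne⟩⟩

theorem MTrans.to_FR (hs : OpInv s) (hΘ : Θ.Good) (h : MTrans mode Θ s a s') :
    MTrans .FR Θ s a s' := by
  refine h.change_mode ?_ ?_
  · rintro t r rfl
    exact hs.idle_of_initiates hΘ (h.thread trivial) trivial r
  · rintro t r d rfl
    exact hs.idle_of_initiates hΘ (h.thread trivial) trivial r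

theorem MTrans.mem_rds (h : MTrans mode Θ s a s') {r : R} {t : T} (ht : t ∈ (s'.rg r).rds) :
    t ∈ (s.rg r).rds ∨ a = .startRead t r := by
  by_cases hr : a.regOf = some r
  · have h' := h.reg hr
    generalize s.rg r = g at *
    generalize s'.rg r = g' at *
    cases h' with
    | startRead t' => exact ht.elim (fun h => .inr (by rw [h])) .inl
    | finishRead => exact .inl ht.1
    | _ => exact .inl ht
  · rw [h.reg_ne hr] at ht
    exact .inl ht

theorem MTrans.mem_wrts (h : MTrans mode Θ s a s') {r : R} {t : T}
    (ht : t ∈ (s'.rg r).wrts) : t ∈ (s.rg r).wrts ∨ ∃ d, a = .startWrite t r d := by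
  by_cases hr : a.regOf = some r
  · have h' := h.reg hr
    generalize s.rg r = g at *
    generalize s'.rg r = g' at *
    cases h' with
    | startWrite t' d => exact ht.elim (fun h => .inr ⟨d, by rw [h]⟩) .inl
    | finishWrite => exact .inl ht.1
    | _ => exact .inl ht
  · rw [h.reg_ne hr] at ht
    exact .inl ht

/-- The threads whose operations on `r` prevent the start action `a` in the model `mode`. -/
def blockers (mode : OverlapMode) (a : RWAct T R D) (r : R) (s : MState Θ) : Set T :=
  {t | t ∈ (s.rg r).wrts ∨ t ∈ (s.rg r).rds ∧ ¬ concOf mode a (.startRead t r)}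

theorem not_concOf_startWrite {r : R} {t : T} {d : D r}
    (hmode : mode = .A ∨ mode = .I ∨ mode = .S) (ha : a.inStart r) :
    ¬ concOf mode a (.startWrite t r d) := by
  rcases hmode with rfl | rfl | rfl <;> intro h
  · exact h.1.1.2 ⟨r, ha, rfl⟩
  · exact h.1.2 ⟨r, ha, rfl⟩
  · exact h.2 ⟨r, ha, rfl⟩

theorem MTrans.enabled_of_blockers_empty (hmode : mode = .A ∨ mode = .I ∨ mode = .S)
    (h : MTrans .FR Θ s a s') (hb : ∀ r, a.inStart r → blockers mode a r s = ∅) :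
    MTrans mode Θ s a s' := by
  refine h.change_mode ?_ ?_
  · rintro t r rfl
    have hb' := Set.eq_empty_iff_forall_notMem.1 (hb r (.inl rfl))
    have hw : (s.rg r).wrts = ∅ :=
      Set.eq_empty_iff_forall_notMem.2 fun t' ht' => hb' t' (.inl ht')
    have hg := (AtoTrans.startRead_iff.1 (h.reg rfl)).1
    rcases hmode with rfl | rfl | rfl
    · exact ⟨Set.eq_empty_iff_forall_notMem.2 fun t' ht' =>
        hb' t' (.inr ⟨ht', fun hc => hc.2 ⟨r, rfl, rfl⟩⟩), hw⟩
    · exact ⟨hg.1, hw⟩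
    · exact ⟨hg.1, hw⟩
  · rintro t r d rfl
    have hb' := Set.eq_empty_iff_forall_notMem.1 (hb r (.inr rfl))
    have hw : (s.rg r).wrts = ∅ :=
      Set.eq_empty_iff_forall_notMem.2 fun t' ht' => hb' t' (.inl ht')
    rcases hmode with rfl | rfl | rfl
    · exact ⟨Set.eq_empty_iff_forall_notMem.2 fun t' ht' =>
        hb' t' (.inr ⟨ht', fun hc => hc.1.2 ⟨r, rfl, rfl⟩⟩), hw⟩
    · exact ⟨Set.eq_empty_iff_forall_notMem.2 fun t' ht' =>
        hb' t' (.inr ⟨ht', fun hc => hc.2 ⟨r, rfl, rfl⟩⟩), hw⟩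
    · exact hw

/-- Enabledness of a start action of the full model only depends on the view of its thread. -/
theorem EnabledIn.of_sameView {r : R} (ha : a.inStart r)
    (h : EnabledIn (MTrans .FR Θ) a s) (hv : SameView s s' a.thr) :
    EnabledIn (MTrans .FR Θ) a s' := by
  classical
  obtain ⟨s₁, h⟩ := h
  cases a with
  | startRead t r' =>
    have hg := (AtoTrans.startRead_iff.1 (h.reg rfl)).1
    have htr := h.thread trivial
    rw [← hv.th] at htr
    exact ⟨_, MTrans.of_sync trivial rfl htr (.startRead _ t
      ⟨fun h => hg.1 ((hv.rds _).1 h), fun h => hg.2 ((hv.wrts _).1 h)⟩)⟩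
  | startWrite t r' d =>
    have hg := (AtoTrans.startWrite_iff.1 (h.reg rfl)).1
    have htr := h.thread trivial
    rw [← hv.th] at htr
    exact ⟨_, MTrans.of_sync trivial rfl htr (.startWrite _ t d
      ⟨fun h => hg.1 ((hv.rds _).1 h), fun h => hg.2 ((hv.wrts _).1 h)⟩)⟩
  | read t r' d => exact absurd (h.reg rfl) AtoTrans.not_read
  | _ => exact (ha.elim id id).elim

theorem RWAct.inStart_unique {r r' : R} (h : a.inStart r) (h' : a.inStart r') : r = r' := by
  cases a <;>
    simp_all [RWAct.inStart, RWAct.isReadStart, RWAct.isWriteStart]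

variable {σ : ℕ → MState Θ} {α : ℕ → Option (RWAct T R D)} {d0 : ∀ r, D r}

theorem finite_ops (hrun : IsRun (MTrans mode Θ) (Minit Θ d0) σ α) (n : ℕ) (r : R) :
    ((σ n).rg r).rds.Finite ∧ ((σ n).rg r).wrts.Finite := by
  induction n with
  | zero =>
    rw [hrun.1]
    exact ⟨Set.finite_empty, Set.finite_empty⟩
  | succ n ih =>
    cases h : α n with
    | none => exact hrun.idle h ▸ ih
    | some a =>
      have hstep := hrun.step h
      refine ⟨(ih.1.insert a.thr).subset fun t ht => ?_,
        (ih.2.insert a.thr).subset fun t ht => ?_⟩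
      · rcases hstep.mem_rds ht with h | rfl
        exacts [.inr h, .inl rfl]
      · rcases hstep.mem_wrts ht with h | ⟨d, rfl⟩
        exacts [.inr h, .inl rfl]

theorem JustRun.to_FR (hΘ : Θ.Good) (hmode : mode = .A ∨ mode = .I ∨ mode = .S)
    (hrun : IsRun (MTrans mode Θ) (Minit Θ d0) σ α)
    (hjust : JustRun (MTrans mode Θ) (concOf mode) Blk σ α) :
    JustRun (MTrans .FR Θ) (concOf mode) Blk σ α := by
  intro n a haB hen
  by_cases hst : ∃ r, a.inStart r
  swap
  · obtain ⟨s', h⟩ := hen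
    exact hjust n a haB ⟨s', h.enabled_of_blockers_empty hmode fun r hr => absurd ⟨r, hr⟩ hst⟩
  obtain ⟨r, har⟩ := hst
  by_contra! hcon
  have hmono : ∀ k, n ≤ k → blockers mode a r (σ (k + 1)) ⊆ blockers mode a r (σ k) := by
    intro k hk t ht
    cases h : α k with
    | none => exact hrun.idle h ▸ ht
    | some b =>
      have hstep := hrun.step h
      have hc := hcon k hk b h
      rcases ht with ht | ⟨ht, hnc⟩
      · rcases hstep.mem_wrts ht with h' | ⟨d, rfl⟩
        · exact .inl h'
        · exact absurd hc (not_concOf_startWrite hmode har)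
      · rcases hstep.mem_rds ht with h' | rfl
        · exact .inr ⟨h', hnc⟩
        · exact absurd hc hnc
  have hanti : ∀ k m, n ≤ k → k ≤ m → blockers mode a r (σ m) ⊆ blockers mode a r (σ k) := by
    intro k m hk hm
    induction m, hm using Nat.le_induction with
    | base => exact subset_rfl
    | succ m hm ih => exact (hmono m (by omega)).trans ih
  have hfin : (blockers mode a r (σ n)).Finite :=
    ((finite_ops hrun n r).2.union (finite_ops hrun n r).1).subset fun t ht =>
      ht.imp id And.left
  have hev : ∀ᶠ k in Filter.atTop,
      ∀ t ∈ blockers mode a r (σ n), t ∉ blockers mode a r (σ k) := by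
    rw [Filter.eventually_all_finite hfin]
    intro t _
    obtain ⟨k, hk, hidle⟩ := exists_idle (t := t) hrun hΘ hjust n
    filter_upwards [Filter.eventually_ge_atTop k] with m hm ht
    rcases hanti k m hk hm ht with h | h
    exacts [(hidle r).2 h, (hidle r).1 h.1]
  obtain ⟨k, hk, hnk⟩ := (hev.and (Filter.eventually_ge_atTop n)).exists
  have hempty : blockers mode a r (σ k) = ∅ :=
    Set.eq_empty_iff_forall_notMem.2 fun t ht => hk t (hanti n k le_rfl hnk ht) ht
  have hsil : Silent α a.thr n k := fun i hi _ b hb hbt =>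
    not_concOf_of_thr_eq hbt.symm (hcon i hi b hb)
  obtain ⟨s', hs'⟩ := hen.of_sameView har (hsil.sameView hrun hnk)
  obtain ⟨j, hj, b, hb, hc⟩ := hjust k a haB ⟨s', hs'.enabled_of_blockers_empty hmode
    fun r' hr' => RWAct.inStart_unique har hr' ▸ hempty⟩
  exact hc (hcon j (hnk.trans hj) b hb)

theorem IsRun.to_FR (hΘ : Θ.Good) (hrun : IsRun (MTrans mode Θ) (Minit Θ d0) σ α) :
    IsRun (MTrans .FR Θ) (Minit Θ d0) σ α := by
  refine ⟨hrun.1, fun n => ?_⟩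
  cases h : α n with
  | none => exact hrun.idle h
  | some a => exact (hrun.step h).to_FR (opInv_run hrun hΘ n) hΘ

end RestrictedToFull

section Normalization

set_option linter.unusedSectionVars false

variable {T R : Type} {D : R → Type} [DecidableEq T] {Θ : ThreadSys T R D}
variable {mode cm : OverlapMode} {s s' : MState Θ} {a b : RWAct T R D}

/-- The actions by which normalization replaces an action `o` performed in state `s`:
an order action becomes its whole operation, and invocations and responses disappear. -/
def normBlock (s : MState Θ) : Option (RWAct T R D) → ℕ → Option (RWAct T R D)
  | some (.orderRead t r), 0 => some (.startRead t r)
  | some (.orderRead t r), 1 => some (.orderRead t r)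
  | some (.orderRead t r), 2 => some (.finishRead t r (s.rg r).stor)
  | some (.orderWrite t r), 0 => some (.startWrite t r ((s.rg r).recv t))
  | some (.orderWrite t r), 1 => some (.orderWrite t r)
  | some (.orderWrite t r), 2 => some (.finishWrite t r)
  | some (.crit t), 0 => some (.crit t)
  | some (.noncrit t), 0 => some (.noncrit t)
  | some (.tloc t n), 0 => some (.tloc t n)
  | _, _ => none

/-- No register operation is in progress. -/
def Quiet (s : MState Θ) : Prop :=
  ∀ r, (s.rg r).rds = ∅ ∧ (s.rg r).wrts = ∅ ∧ (s.rg r).pend = ∅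

/-- Every thread performing an operation in `s` is the one performing `o`. -/
def BusyActs (s : MState Θ) (o : Option (RWAct T R D)) : Prop :=
  ∀ t, ¬ Idle s t → ∃ b, o = some b ∧ b.thr = t

theorem Quiet.idle (h : Quiet s) (t : T) : Idle s t := fun r => by
  simp [(h r).1, (h r).2.1]

theorem Quiet.busyActs (h : Quiet s) (o : Option (RWAct T R D)) : BusyActs s o :=
  fun t ht => absurd (h.idle t) ht

theorem gRead_of_empty {T D : Type} {g : RegState T D} (h1 : g.rds = ∅) (h2 : g.wrts = ∅)
    (t : T) : gRead mode g t := by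
  cases mode <;> simp [gRead, h1, h2]

theorem gWrite_of_empty {T D : Type} {g : RegState T D} (h1 : g.rds = ∅) (h2 : g.wrts = ∅)
    (t : T) : gWrite mode g t := by
  cases mode <;> simp [gWrite, h1, h2]

theorem Quiet.exists_read (hq : Quiet s) {t : T} {r : R} {m x : Θ.TS t}
    (h1 : Θ.tr t (s.th t) (.startRead t r) m)
    (h2 : Θ.tr t m (.finishRead t r (s.rg r).stor) x) :
    ∃ s₁ s₂ s₃ : MState Θ, MTrans mode Θ s (.startRead t r) s₁ ∧
      MTrans mode Θ s₁ (.orderRead t r) s₂ ∧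
      MTrans mode Θ s₂ (.finishRead t r (s.rg r).stor) s₃ ∧
      BusyActs s₁ (some (.orderRead t r)) ∧
      BusyActs s₂ (some (.finishRead t r (s.rg r).stor)) ∧
      Quiet s₃ ∧ (∀ r, (s₃.rg r).stor = (s.rg r).stor) ∧ s₃.th = Function.update s.th t x := by
  classical
  obtain ⟨e1, e2, e3⟩ := hq r
  have hbusy : ∀ (th : ∀ t, Θ.TS t) (g : RegState T (D r)) (b : RWAct T R D), b.thr = t →
      g.rds = {t} → g.wrts = ∅ → BusyActs ⟨th, Function.update s.rg r g⟩ (some b) := by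
    intro th g b hb hg hg' t' ht'
    refine ⟨b, rfl, ?_⟩
    by_contra hne
    refine ht' fun r' => ?_
    by_cases hr : r' = r
    · subst hr
      simp only [Function.update_self, hg, hg']
      exact ⟨fun h => hne (hb.trans h.symm), fun h => h⟩
    · simp only [Function.update_of_ne hr]
      exact hq.idle t' r'
  let g₁ : RegState T (D r) := ⟨(s.rg r).stor, {t}, ∅, {t}, (s.rg r).recv⟩
  let g₂ : RegState T (D r) :=
    ⟨(s.rg r).stor, {t}, ∅, ∅, Function.update (s.rg r).recv t (s.rg r).stor⟩
  let g₃ : RegState T (D r) :=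
    ⟨(s.rg r).stor, ∅, ∅, ∅, Function.update (s.rg r).recv t (s.rg r).stor⟩
  have a1 : AtoTrans mode r (s.rg r) (.startRead t r) g₁ :=
    AtoTrans.startRead_iff.2 ⟨gRead_of_empty e1 e2 t, by simp [g₁, e1, e2, e3]⟩
  have a2 : AtoTrans mode r g₁ (.orderRead t r) g₂ :=
    AtoTrans.orderRead_iff.2 ⟨rfl, rfl, by simp [g₁, g₂]⟩
  have a3 : AtoTrans mode r g₂ (.finishRead t r (s.rg r).stor) g₃ :=
    AtoTrans.finishRead_iff.2 ⟨rfl, by simp [g₂], by simp [g₂], by simp [g₂, g₃]⟩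
  refine ⟨⟨Function.update s.th t m, Function.update s.rg r g₁⟩,
    ⟨Function.update s.th t m, Function.update s.rg r g₂⟩,
    ⟨Function.update s.th t x, Function.update s.rg r g₃⟩, ?_, ?_, ?_,
    hbusy _ _ _ rfl rfl rfl, hbusy _ _ _ rfl rfl rfl, ?_, ?_, rfl⟩
  · exact MTrans.of_sync trivial rfl h1 a1
  · have := MTrans.of_register (mode := mode) (Θ := Θ) (a := .orderRead t r) (r := r)
      (s := ⟨Function.update s.th t m, Function.update s.rg r g₁⟩) (g := g₂)
      (fun h => h) rfl (by simpa using a2)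
    simpa using this
  · have := MTrans.of_sync (mode := mode) (Θ := Θ) (a := .finishRead t r (s.rg r).stor) (r := r)
      (s := ⟨Function.update s.th t m, Function.update s.rg r g₂⟩) (g := g₃) (x := x)
      trivial rfl (by simpa [RWAct.thr] using h2) (by simpa using a3)
    simpa [RWAct.thr] using this
  · intro r'
    by_cases hr : r' = r
    · subst hr
      simp [g₃]
    · simpa [Function.update_of_ne hr] using hq r'
  · intro r'
    by_cases hr : r' = r
    · subst hr
      simp [g₃]
    · simp [Function.update_of_ne hr]

theorem Quiet.exists_write (hq : Quiet s) {t : T} {r : R} {d : D r} {m x : Θ.TS t}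
    (h1 : Θ.tr t (s.th t) (.startWrite t r d) m) (h2 : Θ.tr t m (.finishWrite t r) x) :
    ∃ s₁ s₂ s₃ : MState Θ, MTrans mode Θ s (.startWrite t r d) s₁ ∧
      MTrans mode Θ s₁ (.orderWrite t r) s₂ ∧ MTrans mode Θ s₂ (.finishWrite t r) s₃ ∧
      BusyActs s₁ (some (.orderWrite t r)) ∧ BusyActs s₂ (some (.finishWrite t r)) ∧
      Quiet s₃ ∧ (s₃.rg r).stor = d ∧ (∀ r', r' ≠ r → (s₃.rg r').stor = (s.rg r').stor) ∧
      s₃.th = Function.update s.th t x := by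
  classical
  obtain ⟨e1, e2, e3⟩ := hq r
  have hbusy : ∀ (th : ∀ t, Θ.TS t) (g : RegState T (D r)) (b : RWAct T R D), b.thr = t →
      g.rds = ∅ → g.wrts = {t} → BusyActs ⟨th, Function.update s.rg r g⟩ (some b) := by
    intro th g b hb hg hg' t' ht'
    refine ⟨b, rfl, ?_⟩
    by_contra hne
    refine ht' fun r' => ?_
    by_cases hr : r' = r
    · subst hr
      simp only [Function.update_self, hg, hg']
      exact ⟨fun h => h, fun h => hne (hb.trans h.symm)⟩
    · simp only [Function.update_of_ne hr]
      exact hq.idle t' r'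
  let g₁ : RegState T (D r) :=
    ⟨(s.rg r).stor, ∅, {t}, {t}, Function.update (s.rg r).recv t d⟩
  let g₂ : RegState T (D r) := ⟨d, ∅, {t}, ∅, Function.update (s.rg r).recv t d⟩
  let g₃ : RegState T (D r) := ⟨d, ∅, ∅, ∅, Function.update (s.rg r).recv t d⟩
  have a1 : AtoTrans mode r (s.rg r) (.startWrite t r d) g₁ :=
    AtoTrans.startWrite_iff.2 ⟨gWrite_of_empty e1 e2 t, by simp [g₁, e1, e2, e3]⟩
  have a2 : AtoTrans mode r g₁ (.orderWrite t r) g₂ :=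
    AtoTrans.orderWrite_iff.2 ⟨rfl, rfl, by simp [g₁, g₂]⟩
  have a3 : AtoTrans mode r g₂ (.finishWrite t r) g₃ :=
    AtoTrans.finishWrite_iff.2 ⟨rfl, by simp [g₂], by simp [g₂, g₃]⟩
  refine ⟨⟨Function.update s.th t m, Function.update s.rg r g₁⟩,
    ⟨Function.update s.th t m, Function.update s.rg r g₂⟩,
    ⟨Function.update s.th t x, Function.update s.rg r g₃⟩, ?_, ?_, ?_,
    hbusy _ _ _ rfl rfl rfl, hbusy _ _ _ rfl rfl rfl, ?_, ?_, ?_, rfl⟩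
  · exact MTrans.of_sync trivial rfl h1 a1
  · have := MTrans.of_register (mode := mode) (Θ := Θ) (a := .orderWrite t r) (r := r)
      (s := ⟨Function.update s.th t m, Function.update s.rg r g₁⟩) (g := g₂)
      (fun h => h) rfl (by simpa using a2)
    simpa using this
  · have := MTrans.of_sync (mode := mode) (Θ := Θ) (a := .finishWrite t r) (r := r)
      (s := ⟨Function.update s.th t m, Function.update s.rg r g₂⟩) (g := g₃) (x := x)
      trivial rfl (by simpa [RWAct.thr] using h2) (by simpa using a3)
    simpa [RWAct.thr] using this
  · intro r'
    by_cases hr : r' = r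
    · subst hr
      simp [g₃]
    · simpa [Function.update_of_ne hr] using hq r'
  · simp [g₃]
  · intro r' hr
    simp [Function.update_of_ne hr]

variable {σ : ℕ → MState Θ} {α : ℕ → Option (RWAct T R D)} {d0 : ∀ r, D r} {t : T} {n : ℕ}

/-- The state `x` of thread `t` in the normalized run corresponds to position `n` of the run:
pending operations have not started yet, ordered operations are already completed. -/
structure ThreadRel (σ : ℕ → MState Θ) (α : ℕ → Option (RWAct T R D)) (n : ℕ) (t : T)
    (x : Θ.TS t) : Prop where
  idle : Idle (σ n) t → x = (σ n).th t
  reading : ∀ r, t ∈ ((σ n).rg r).rds → t ∈ ((σ n).rg r).pend →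
    Θ.tr t x (.startRead t r) ((σ n).th t)
  writing : ∀ r, t ∈ ((σ n).rg r).wrts → t ∈ ((σ n).rg r).pend →
    Θ.tr t x (.startWrite t r (((σ n).rg r).recv t)) ((σ n).th t)
  done : ∀ r, (t ∈ ((σ n).rg r).rds ∨ t ∈ ((σ n).rg r).wrts) → t ∉ ((σ n).rg r).pend →
    ∃ j b, n ≤ j ∧ α j = some b ∧ b.thr = t ∧ Silent α t n j ∧ x = (σ (j + 1)).th t

/-- The state `s` of the normalized run corresponds to position `n` of the run. -/
structure NormRel (σ : ℕ → MState Θ) (α : ℕ → Option (RWAct T R D)) (n : ℕ)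
    (s : MState Θ) : Prop where
  quiet : Quiet s
  stor : ∀ r, (s.rg r).stor = ((σ n).rg r).stor
  thread : ∀ t, ThreadRel σ α n t (s.th t)

theorem ThreadRel.of_idle (h : Idle (σ n) t) : ThreadRel σ α n t ((σ n).th t) where
  idle _ := rfl
  reading r hr := absurd hr (h r).1
  writing r hr := absurd hr (h r).2
  done r hr := absurd hr (not_or.2 (h r))

theorem ThreadRel.succ {x : Θ.TS t} (h : ThreadRel σ α n t x)
    (hne : ∀ b, α n = some b → b.thr ≠ t) (hv : SameView (σ n) (σ (n + 1)) t) :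
    ThreadRel σ α (n + 1) t x where
  idle hi := by
    rw [hv.th]
    exact h.idle fun r => ⟨fun hr => (hi r).1 ((hv.rds r).2 hr),
      fun hr => (hi r).2 ((hv.wrts r).2 hr)⟩
  reading r hr hp := by
    rw [hv.th]
    exact h.reading r ((hv.rds r).1 hr) ((hv.pend r).1 hp)
  writing r hr hp := by
    rw [hv.th, hv.recv]
    exact h.writing r ((hv.wrts r).1 hr) ((hv.pend r).1 hp)
  done r hr hp := by
    obtain ⟨j, b, h1, h2, h3, h4, h5⟩ := h.done r (hr.imp (hv.rds r).1 (hv.wrts r).1)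
      fun hp' => hp ((hv.pend r).2 hp')
    have hj : j ≠ n := by
      rintro rfl
      exact hne b h2 h3
    exact ⟨j, b, by omega, h2, h3, fun i hi => h4 i (by omega), h5⟩

theorem MTrans.stor_eq {mode : OverlapMode} (h : MTrans mode Θ s a s') {r : R}
    (ha : ∀ t, a ≠ .orderWrite t r) : (s'.rg r).stor = (s.rg r).stor := by
  by_cases hr : a.regOf = some r
  · have h' := h.reg hr
    generalize s.rg r = g at *
    generalize s'.rg r = g' at *
    cases h' with
    | orderWrite t => exact absurd rfl (ha t)
    | _ => rfl
  · rw [h.reg_ne hr]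

section

variable (hrun : IsRun (MTrans .FR Θ) (Minit Θ d0) σ α) (hΘ : Θ.Good)
  (hjust : JustRun (MTrans .FR Θ) (concOf cm) Blk σ α)

include hrun hΘ

theorem NormRel.local_step {s : MState Θ} (h : NormRel σ α n s) (ha : α n = some a)
    (hi : a.Initiates) (hr : a.regOf = none) :
    ∃ s', MTrans mode Θ s a s' ∧ NormRel σ α (n + 1) s' := by
  have hstep := hrun.step ha
  have htr := hstep.thread hi.isThreadAct
  have hidle := (opInv_run hrun hΘ n).idle_of_initiates hΘ htr hi
  have hidle' : Idle (σ (n + 1)) a.thr := fun r => by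
    rw [hstep.reg_ne (by simp [hr])]
    exact hidle r
  rw [← (h.thread a.thr).idle hidle] at htr
  refine ⟨_, MTrans.of_local hi.isThreadAct hr htr, h.quiet, fun r => ?_, fun t => ?_⟩
  · rw [hstep.stor_eq (by rintro t rfl; cases hr)]
    exact h.stor r
  · by_cases hat : t = a.thr
    · subst hat
      simpa using ThreadRel.of_idle hidle'
    · simp only [Function.update_of_ne hat]
      exact (h.thread t).succ (fun b hb => by
        rw [ha] at hb
        cases hb
        exact Ne.symm hat) (hstep.sameView (Ne.symm hat))

theorem NormRel.silent_step {s : MState Θ} (h : NormRel σ α n s) (ha : α n = some a)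
    (hw : ∀ t r, a ≠ .orderWrite t r) (ht : ThreadRel σ α (n + 1) a.thr (s.th a.thr)) :
    NormRel σ α (n + 1) s := by
  have hstep := hrun.step ha
  refine ⟨h.quiet, fun r => ?_, fun t => ?_⟩
  · rw [hstep.stor_eq fun t => hw t r]
    exact h.stor r
  · by_cases hat : a.thr = t
    · subst hat
      exact ht
    · exact (h.thread t).succ (fun b hb => by
        rw [ha] at hb
        cases hb
        exact hat) (hstep.sameView hat)

theorem NormRel.finish_step {s : MState Θ} (h : NormRel σ α n s) (ha : α n = some a)
    (hf : (∃ t r d, a = .finishRead t r d) ∨ ∃ t r, a = .finishWrite t r) :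
    NormRel σ α (n + 1) s := by
  have hstep := hrun.step ha
  have hI := opInv_run hrun hΘ n
  refine h.silent_step hrun hΘ ha (by rcases hf with ⟨t, r, d, rfl⟩ | ⟨t, r, rfl⟩ <;> simp) ?_
  have hidle := hI.idle_of_finish hΘ hstep hf
  obtain ⟨r, hr, hp⟩ : ∃ r, (a.thr ∈ ((σ n).rg r).rds ∨ a.thr ∈ ((σ n).rg r).wrts) ∧
      a.thr ∉ ((σ n).rg r).pend := by
    rcases hf with ⟨t, r, d, rfl⟩ | ⟨t, r, rfl⟩
    · have := AtoTrans.finishRead_iff.1 (hstep.reg rfl)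
      exact ⟨r, .inl this.1, this.2.1⟩
    · have := AtoTrans.finishWrite_iff.1 (hstep.reg rfl)
      exact ⟨r, .inr this.1, this.2.1⟩
  obtain ⟨j, b, hj, hb, hbt, hsil, hx⟩ := (h.thread a.thr).done r hr hp
  have hjn : j = n := by
    by_contra hne
    exact hsil n le_rfl (by omega) a ha rfl
  subst hjn
  rw [hx]
  exact .of_idle hidle

theorem NormRel.startRead_step {s : MState Θ} {r : R} (h : NormRel σ α n s)
    (ha : α n = some (.startRead t r)) : NormRel σ α (n + 1) s := by
  have hstep := hrun.step ha
  have htr := hstep.thread trivial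
  have hi := (opInv_run hrun hΘ n).idle_of_initiates hΘ htr trivial
  have hI' := opInv_run hrun hΘ (n + 1)
  obtain ⟨-, hg⟩ := AtoTrans.startRead_iff.1 (hstep.reg rfl)
  have hrd : t ∈ ((σ (n + 1)).rg r).rds := by rw [hg]; simp
  have hpd : t ∈ ((σ (n + 1)).rg r).pend := by rw [hg]; simp
  refine h.silent_step hrun hΘ ha (by simp) ⟨fun hi' => absurd hrd (hi' r).1, ?_, ?_, ?_⟩
  · intro r' hr' _
    obtain rfl := hI'.rds_unique hΘ hrd hr'
    change Θ.tr t (s.th t) (.startRead t r') ((σ (n + 1)).th t)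
    rw [(h.thread t).idle hi]
    exact htr
  · exact fun r' hr' => absurd hr' (hI'.not_wrts_of_rds hΘ hrd)
  · rintro r' (hr' | hr') hp
    · obtain rfl := hI'.rds_unique hΘ hrd hr'
      exact absurd hpd hp
    · exact absurd hr' (hI'.not_wrts_of_rds hΘ hrd)

theorem NormRel.startWrite_step {s : MState Θ} {r : R} {d : D r} (h : NormRel σ α n s)
    (ha : α n = some (.startWrite t r d)) : NormRel σ α (n + 1) s := by
  have hstep := hrun.step ha
  have htr := hstep.thread trivial
  have hi := (opInv_run hrun hΘ n).idle_of_initiates hΘ htr trivial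
  have hI' := opInv_run hrun hΘ (n + 1)
  obtain ⟨-, hg⟩ := AtoTrans.startWrite_iff.1 (hstep.reg rfl)
  have hwr : t ∈ ((σ (n + 1)).rg r).wrts := by rw [hg]; simp
  have hpd : t ∈ ((σ (n + 1)).rg r).pend := by rw [hg]; simp
  have hrc : ((σ (n + 1)).rg r).recv t = d := by rw [hg]; simp
  refine h.silent_step hrun hΘ ha (by simp) ⟨fun hi' => absurd hwr (hi' r).2, ?_, ?_, ?_⟩
  · exact fun r' hr' => absurd hwr (hI'.not_wrts_of_rds hΘ hr')
  · intro r' hr' _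
    obtain rfl := hI'.wrts_unique hΘ hwr hr'
    change Θ.tr t (s.th t) (.startWrite t r' (((σ (n + 1)).rg r').recv t)) ((σ (n + 1)).th t)
    rw [(h.thread t).idle hi, hrc]
    exact htr
  · rintro r' (hr' | hr') hp
    · exact absurd hwr (hI'.not_wrts_of_rds hΘ hr')
    · obtain rfl := hI'.wrts_unique hΘ hwr hr'
      exact absurd hpd hp

include hjust

theorem NormRel.orderRead_step {s : MState Θ} {r : R} (h : NormRel σ α n s)
    (ha : α n = some (.orderRead t r)) :
    ∃ s₁ s₂ s₃ : MState Θ, MTrans mode Θ s (.startRead t r) s₁ ∧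
      MTrans mode Θ s₁ (.orderRead t r) s₂ ∧
      MTrans mode Θ s₂ (.finishRead t r ((σ n).rg r).stor) s₃ ∧
      BusyActs s₁ (some (.orderRead t r)) ∧
      BusyActs s₂ (some (.finishRead t r ((σ n).rg r).stor)) ∧ NormRel σ α (n + 1) s₃ := by
  have hstep := hrun.step ha
  have hI' := opInv_run hrun hΘ (n + 1)
  obtain ⟨h1, h2, hg⟩ := AtoTrans.orderRead_iff.1 (hstep.reg rfl)
  have hrd : t ∈ ((σ (n + 1)).rg r).rds := by rw [hg]; exact h1
  have hpd : t ∉ ((σ (n + 1)).rg r).pend := by rw [hg]; simp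
  have hrc : ((σ (n + 1)).rg r).recv t = ((σ n).rg r).stor := by rw [hg]; simp
  obtain ⟨j, b, hj, hb, hbt, hsil, hv, hfin, -⟩ := exists_finish hrun hΘ hjust (.inl hrd) hpd
  rcases hfin with ⟨-, rfl⟩ | ⟨hw, -⟩
  swap
  · exact absurd hw (hI'.not_wrts_of_rds hΘ hrd)
  have htr := (hrun.step hb).thread trivial
  rw [hrc, ← h.stor r] at htr
  simp only [RWAct.thr] at htr
  rw [hv.th, hstep.th_of_not_isThreadAct (fun h => h)] at htr
  obtain ⟨s₁, s₂, s₃, t1, t2, t3, b1, b2, hq, hst, hth⟩ :=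
    h.quiet.exists_read (mode := mode) ((h.thread t).reading r h1 h2) htr
  rw [h.stor r] at t3 b2
  refine ⟨s₁, s₂, s₃, t1, t2, t3, b1, b2, hq, fun r' => ?_, fun t' => ?_⟩
  · rw [hst, h.stor, hstep.stor_eq (by simp)]
  · by_cases htt : t' = t
    · subst htt
      rw [hth, Function.update_self]
      refine ⟨fun hi => absurd hrd (hi r).1, fun r' hr' hp => ?_, fun r' hr' _ => ?_,
        fun r' _ _ => ⟨j, _, hj, hb, rfl, hsil, rfl⟩⟩
      · obtain rfl := hI'.rds_unique hΘ hrd hr'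
        exact absurd hp hpd
      · exact absurd hr' (hI'.not_wrts_of_rds hΘ hrd)
    · rw [hth, Function.update_of_ne htt]
      exact (h.thread t').succ (fun b hb => by
        rw [ha] at hb
        cases hb
        exact Ne.symm htt) (hstep.sameView (Ne.symm htt))

theorem NormRel.orderWrite_step {s : MState Θ} {r : R} (h : NormRel σ α n s)
    (ha : α n = some (.orderWrite t r)) :
    ∃ s₁ s₂ s₃ : MState Θ, MTrans mode Θ s (.startWrite t r (((σ n).rg r).recv t)) s₁ ∧
      MTrans mode Θ s₁ (.orderWrite t r) s₂ ∧ MTrans mode Θ s₂ (.finishWrite t r) s₃ ∧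
      BusyActs s₁ (some (.orderWrite t r)) ∧ BusyActs s₂ (some (.finishWrite t r)) ∧
      NormRel σ α (n + 1) s₃ := by
  have hstep := hrun.step ha
  have hI' := opInv_run hrun hΘ (n + 1)
  obtain ⟨h1, h2, hg⟩ := AtoTrans.orderWrite_iff.1 (hstep.reg rfl)
  have hwr : t ∈ ((σ (n + 1)).rg r).wrts := by rw [hg]; exact h1
  have hpd : t ∉ ((σ (n + 1)).rg r).pend := by rw [hg]; simp
  have hsr : ((σ (n + 1)).rg r).stor = ((σ n).rg r).recv t := by rw [hg]
  obtain ⟨j, b, hj, hb, hbt, hsil, hv, hfin, -⟩ := exists_finish hrun hΘ hjust (.inr hwr) hpd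
  rcases hfin with ⟨hr, -⟩ | ⟨-, rfl⟩
  · exact absurd hwr (hI'.not_wrts_of_rds hΘ hr)
  have htr := (hrun.step hb).thread trivial
  simp only [RWAct.thr] at htr
  rw [hv.th, hstep.th_of_not_isThreadAct (fun h => h)] at htr
  obtain ⟨s₁, s₂, s₃, t1, t2, t3, b1, b2, hq, hst, hst', hth⟩ :=
    h.quiet.exists_write (mode := mode) ((h.thread t).writing r h1 h2) htr
  refine ⟨s₁, s₂, s₃, t1, t2, t3, b1, b2, hq, fun r' => ?_, fun t' => ?_⟩
  · by_cases hr : r' = r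
    · subst hr
      rw [hst, hsr]
    · rw [hst' r' hr, h.stor, hstep.reg_ne (by simpa [RWAct.regOf] using Ne.symm hr)]
  · by_cases htt : t' = t
    · subst htt
      rw [hth, Function.update_self]
      refine ⟨fun hi => absurd hwr (hi r).2, fun r' hr' _ => ?_, fun r' hr' hp => ?_,
        fun r' _ _ => ⟨j, _, hj, hb, rfl, hsil, rfl⟩⟩
      · exact absurd hwr (hI'.not_wrts_of_rds hΘ hr')
      · obtain rfl := hI'.wrts_unique hΘ hwr hr'
        exact absurd hp hpd
    · rw [hth, Function.update_of_ne htt]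
      exact (h.thread t').succ (fun b hb => by
        rw [ha] at hb
        cases hb
        exact Ne.symm htt) (hstep.sameView (Ne.symm htt))

theorem NormRel.exists_block {s : MState Θ} (h : NormRel σ α n s) :
    ∃ s₁ s₂ s₃ : MState Θ, OptStep (MTrans mode Θ) s (normBlock (σ n) (α n) 0) s₁ ∧
      OptStep (MTrans mode Θ) s₁ (normBlock (σ n) (α n) 1) s₂ ∧
      OptStep (MTrans mode Θ) s₂ (normBlock (σ n) (α n) 2) s₃ ∧
      BusyActs s₁ (normBlock (σ n) (α n) 1) ∧ BusyActs s₂ (normBlock (σ n) (α n) 2) ∧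
      NormRel σ α (n + 1) s₃ := by
  have hsilent : NormRel σ α (n + 1) s →
      (∀ i, normBlock (σ n) (α n) i = none) → ∃ s₁ s₂ s₃ : MState Θ,
      OptStep (MTrans mode Θ) s (normBlock (σ n) (α n) 0) s₁ ∧
      OptStep (MTrans mode Θ) s₁ (normBlock (σ n) (α n) 1) s₂ ∧
      OptStep (MTrans mode Θ) s₂ (normBlock (σ n) (α n) 2) s₃ ∧
      BusyActs s₁ (normBlock (σ n) (α n) 1) ∧ BusyActs s₂ (normBlock (σ n) (α n) 2) ∧
      NormRel σ α (n + 1) s₃ := by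
    intro h' hb
    simp only [hb]
    exact ⟨s, s, s, rfl, rfl, rfl, h.quiet.busyActs _, h.quiet.busyActs _, h'⟩
  have hlocal : ∀ a, α n = some a → a.Initiates → a.regOf = none →
      (normBlock (σ n) (some a) 0 = some a ∧ normBlock (σ n) (some a) 1 = none ∧
        normBlock (σ n) (some a) 2 = none) → ∃ s₁ s₂ s₃ : MState Θ,
      OptStep (MTrans mode Θ) s (normBlock (σ n) (α n) 0) s₁ ∧
      OptStep (MTrans mode Θ) s₁ (normBlock (σ n) (α n) 1) s₂ ∧
      OptStep (MTrans mode Θ) s₂ (normBlock (σ n) (α n) 2) s₃ ∧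
      BusyActs s₁ (normBlock (σ n) (α n) 1) ∧ BusyActs s₂ (normBlock (σ n) (α n) 2) ∧
      NormRel σ α (n + 1) s₃ := by
    rintro a ha hi hr ⟨e0, e1, e2⟩
    obtain ⟨s', hs', h'⟩ := h.local_step (mode := mode) hrun hΘ ha hi hr
    rw [ha, e0, e1, e2]
    exact ⟨s', s', s', hs', rfl, rfl, h'.quiet.busyActs _, h'.quiet.busyActs _, h'⟩
  cases ha : α n with
  | none =>
    refine ha ▸ hsilent ⟨h.quiet, fun r => ?_, fun t => ?_⟩ fun i => by rw [ha]; rfl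
    · rw [hrun.idle ha]
      exact h.stor r
    · exact (h.thread t).succ (by simp [ha]) (sameView_succ hrun (by simp [ha]))
  | some a =>
    cases a with
    | startRead t r => exact ha ▸ hsilent (h.startRead_step hrun hΘ ha) fun i => by rw [ha]; rfl
    | startWrite t r d =>
      exact ha ▸ hsilent (h.startWrite_step hrun hΘ ha) fun i => by rw [ha]; rfl
    | finishRead t r d =>
      exact ha ▸ hsilent (h.finish_step hrun hΘ ha (.inl ⟨_, _, _, rfl⟩))
        fun i => by rw [ha]; rfl
    | finishWrite t r =>
      exact ha ▸ hsilent (h.finish_step hrun hΘ ha (.inr ⟨_, _, rfl⟩)) fun i => by rw [ha]; rfl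
    | read t r d => exact absurd ((hrun.step ha).reg rfl) AtoTrans.not_read
    | orderRead t r => exact h.orderRead_step hrun hΘ hjust ha
    | orderWrite t r => exact h.orderWrite_step hrun hΘ hjust ha
    | crit t => exact ha ▸ hlocal _ ha trivial rfl ⟨rfl, rfl, rfl⟩
    | noncrit t => exact ha ▸ hlocal _ ha trivial rfl ⟨rfl, rfl, rfl⟩
    | tloc t k => exact ha ▸ hlocal _ ha trivial rfl ⟨rfl, rfl, rfl⟩

end

end Normalization

section NormalizedRun

set_option linter.unusedSectionVars false

variable {T R : Type} {D : R → Type} [DecidableEq T] {Θ : ThreadSys T R D}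
variable {mode cm : OverlapMode} {a b : RWAct T R D}
variable {σ : ℕ → MState Θ} {α : ℕ → Option (RWAct T R D)} {d0 : ∀ r, D r} {t : T} {n : ℕ}

theorem Idle.enabled_FR {s : MState Θ} (hi : Idle s a.thr) (ha : a.Initiates)
    {x : Θ.TS a.thr} (htr : Θ.tr a.thr (s.th a.thr) a x) : EnabledIn (MTrans .FR Θ) a s := by
  classical
  cases a with
  | startRead t r => exact ⟨_, MTrans.of_sync trivial rfl htr (.startRead _ t (hi r))⟩
  | startWrite t r d => exact ⟨_, MTrans.of_sync trivial rfl htr (.startWrite _ t d (hi r))⟩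
  | crit t => exact ⟨_, MTrans.of_local trivial rfl htr⟩
  | noncrit t => exact ⟨_, MTrans.of_local trivial rfl htr⟩
  | tloc t k => exact ⟨_, MTrans.of_local trivial rfl htr⟩
  | _ => exact ha.elim

theorem MTrans.initiates_or_not_inStart {s s' : MState Θ} (h : MTrans mode Θ s b s') :
    b.Initiates ∨ ∀ r, ¬ b.inStart r := by
  cases b with
  | startRead | startWrite | crit | noncrit | tloc => exact .inl trivial
  | orderRead | finishRead | orderWrite | finishWrite => exact .inr fun _ h => h.elim id id
  | read t r d => exact absurd (h.reg rfl) AtoTrans.not_read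

/-- The actions of the normalized run: block `n` consists of the positions `3 * n`,
`3 * n + 1`, `3 * n + 2`. -/
def normActs (σ : ℕ → MState Θ) (α : ℕ → Option (RWAct T R D)) (p : ℕ) :
    Option (RWAct T R D) :=
  normBlock (σ (p / 3)) (α (p / 3)) (p % 3)

theorem normActs_eq {i : ℕ} (hi : i < 3) :
    normActs σ α (3 * n + i) = normBlock (σ n) (α n) i := by
  rw [normActs, show (3 * n + i) / 3 = n by omega, show (3 * n + i) % 3 = i by omega]

section

variable (hrun : IsRun (MTrans .FR Θ) (Minit Θ d0) σ α) (hΘ : Θ.Good)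
  (hjust : JustRun (MTrans .FR Θ) (concOf cm) Blk σ α)

include hrun

theorem normRel_zero : NormRel σ α 0 (Minit Θ d0) := by
  have h0 := hrun.1
  refine ⟨fun r => ⟨rfl, rfl, rfl⟩, fun r => by rw [h0], fun t => ?_⟩
  rw [← h0]
  exact .of_idle fun r => by simp [h0, Minit]

include hΘ hjust

/-- Every initiating action of the run starts a later block of the normalized run. -/
theorem exists_normBlock_eq (hb : α n = some b) (hi : b.Initiates) :
    ∃ j, n ≤ j ∧ normBlock (σ j) (α j) 0 = some b := by
  have hstep := hrun.step hb
  cases b with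
  | startRead t r =>
    obtain ⟨-, hg⟩ := AtoTrans.startRead_iff.1 (hstep.reg rfl)
    obtain ⟨j, hj, hα⟩ := exists_orderRead (t := t) (r := r) (n := n + 1) hrun hΘ hjust
      (by simp [hg]) (by simp [hg])
    exact ⟨j, by omega, by rw [hα]; rfl⟩
  | startWrite t r d =>
    obtain ⟨-, hg⟩ := AtoTrans.startWrite_iff.1 (hstep.reg rfl)
    obtain ⟨j, hj, hα, hd⟩ := exists_orderWrite (t := t) (r := r) (n := n + 1) hrun hΘ hjust
      (by simp [hg]) (by simp [hg])
    have hd' : ((σ j).rg r).recv t = d := by rw [hd, hg]; simp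
    exact ⟨j, by omega, by rw [hα, ← hd']; rfl⟩
  | crit t => exact ⟨n, le_rfl, by rw [hb]; rfl⟩
  | noncrit t => exact ⟨n, le_rfl, by rw [hb]; rfl⟩
  | tloc t k => exact ⟨n, le_rfl, by rw [hb]; rfl⟩
  | _ => exact hi.elim

/-- The next time thread `t` is idle without having started a further operation, unless it
acts in the normalized run. -/
theorem NormRel.exists_idle_or_acts {s : MState Θ} (h : NormRel σ α n s) (t : T) :
    (∃ k, n ≤ k ∧ Idle (σ k) t ∧ s.th t = (σ k).th t) ∨
      ∃ j, n ≤ j ∧ ∃ b, normBlock (σ j) (α j) 0 = some b ∧ b.thr = t := by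
  by_cases hi : Idle (σ n) t
  · exact .inl ⟨n, le_rfl, hi, (h.thread t).idle hi⟩
  simp only [Idle, not_forall, not_and_or, not_not] at hi
  obtain ⟨r, hr⟩ := hi
  by_cases hp : t ∈ ((σ n).rg r).pend
  · right
    rcases hr with hr | hr
    · obtain ⟨j, hj, hα⟩ := exists_orderRead hrun hΘ hjust hr hp
      exact ⟨j, hj, _, by rw [hα]; rfl, rfl⟩
    · obtain ⟨j, hj, hα, -⟩ := exists_orderWrite hrun hΘ hjust hr hp
      exact ⟨j, hj, _, by rw [hα]; rfl, rfl⟩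
  · left
    obtain ⟨j, b, hj, hb, hbt, hsil, hx⟩ := (h.thread t).done r hr hp
    obtain ⟨i, c, hi, hc, hct, hsil', -, -, hidle⟩ := exists_finish hrun hΘ hjust hr hp
    have hij : i = j := by
      by_contra hne
      rcases Nat.lt_or_gt_of_ne hne with hlt | hlt
      · exact hsil i hi hlt c hc hct
      · exact hsil' j hj hlt b hb hbt
    subst hij
    exact ⟨i + 1, by omega, hidle, hx⟩

theorem NormRel.exists_interfering {s : MState Θ} (h : NormRel σ α n s) (ha : a.Initiates)
    (haB : a ∉ Blk (T := T) (R := R) (D := D)) {x : Θ.TS a.thr}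
    (htr : Θ.tr a.thr (s.th a.thr) a x) :
    ∃ j, n ≤ j ∧ ∃ b, normBlock (σ j) (α j) 0 = some b ∧ ¬ concOf cm a b := by
  rcases h.exists_idle_or_acts hrun hΘ hjust a.thr with ⟨k, hk, hidle, hth⟩ | ⟨j, hj, b, hb, hbt⟩
  swap
  · exact ⟨j, hj, b, hb, not_concOf_of_thr_eq hbt.symm⟩
  rw [hth] at htr
  obtain ⟨j, hj, b, hb, hc⟩ := hjust k a haB (hidle.enabled_FR ha htr)
  rcases (hrun.step hb).initiates_or_not_inStart with hbi | hbs
  · obtain ⟨i, hi, hbi⟩ := exists_normBlock_eq hrun hΘ hjust hb hbi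
    exact ⟨i, by omega, b, hbi, hc⟩
  · obtain ⟨i, c, hi, -, hc, hct, -, hv⟩ :=
      exists_first_act hrun hj hb (thr_eq_of_not_concOf_right hbs hc).symm
    obtain ⟨l, hl, hcl⟩ := exists_normBlock_eq hrun hΘ hjust hc
      ((hidle.of_sameView hv).initiates (hrun.step hc) hct)
    exact ⟨l, by omega, c, hcl, not_concOf_of_thr_eq hct.symm⟩

theorem exists_normalized_run :
    ∃ ρ : ℕ → MState Θ,
      IsRun (MTrans mode Θ) (Minit Θ d0) ρ (normActs σ α) ∧
      (∀ p, BusyActs (ρ p) (normActs σ α p)) ∧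
      ∀ n, NormRel σ α n (ρ (3 * n)) := by
  have hblock := fun (n : ℕ) (s : MState Θ) (h : NormRel σ α n s) =>
    h.exists_block hrun hΘ hjust (mode := mode)
  have : Nonempty (MState Θ) := ⟨Minit Θ d0⟩
  choose! F₁ F₂ F₃ h₁ h₂ h₃ hb₁ hb₂ hrel using hblock
  let N : ℕ → MState Θ := fun n => Nat.rec (Minit Θ d0) F₃ n
  have hN : ∀ n, NormRel σ α n (N n) := by
    intro n
    induction n with
    | zero => exact normRel_zero hrun
    | succ n ih => exact hrel n _ ih
  let ρ : ℕ → MState Θ := fun p =>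
    match p % 3 with
    | 0 => N (p / 3)
    | 1 => F₁ (p / 3) (N (p / 3))
    | _ => F₂ (p / 3) (N (p / 3))
  have hρ : ∀ n, ρ (3 * n) = N n ∧ ρ (3 * n + 1) = F₁ n (N n) ∧ ρ (3 * n + 2) = F₂ n (N n) := by
    intro n
    simp [ρ, Nat.mul_add_div]
  have hcase : ∀ p, ∃ n, p = 3 * n + 0 ∨ p = 3 * n + 1 ∨ p = 3 * n + 2 := fun p =>
    ⟨p / 3, by omega⟩
  refine ⟨ρ, ⟨rfl, fun p => ?_⟩, fun p => ?_, fun n => by rw [(hρ n).1]; exact hN n⟩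
  · obtain ⟨n, rfl | rfl | rfl⟩ := hcase p <;> rw [normActs_eq (by omega)]
    · rw [Nat.add_zero, (hρ n).1, (hρ n).2.1]
      exact h₁ n _ (hN n)
    · rw [(hρ n).2.1, (hρ n).2.2]
      exact h₂ n _ (hN n)
    · rw [(hρ n).2.2, show 3 * n + 2 + 1 = 3 * (n + 1) by omega, (hρ (n + 1)).1]
      exact h₃ n _ (hN n)
  · obtain ⟨n, rfl | rfl | rfl⟩ := hcase p <;> rw [normActs_eq (by omega)]
    · rw [Nat.add_zero, (hρ n).1]
      exact (hN n).quiet.busyActs _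
    · rw [(hρ n).2.1]
      exact hb₁ n _ (hN n)
    · rw [(hρ n).2.2]
      exact hb₂ n _ (hN n)

theorem justRun_normalized {ρ : ℕ → MState Θ}
    (hρ : IsRun (MTrans mode Θ) (Minit Θ d0) ρ (normActs σ α))
    (hbusy : ∀ p, BusyActs (ρ p) (normActs σ α p))
    (hrel : ∀ n, NormRel σ α n (ρ (3 * n))) :
    JustRun (MTrans mode Θ) (concOf cm) Blk ρ (normActs σ α) := by
  rintro p a haB ⟨s', hs'⟩
  by_cases hidle : Idle (ρ p) a.thr
  swap
  · obtain ⟨b, hb, hbt⟩ := hbusy p _ hidle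
    exact ⟨p, le_rfl, b, hb, not_concOf_of_thr_eq hbt.symm⟩
  have hai := hidle.initiates hs' rfl
  have hp : p ≤ 3 * ((p + 2) / 3) := by omega
  by_cases hsil : Silent (normActs σ α) a.thr p (3 * ((p + 2) / 3))
  · have htr := hs'.thread hai.isThreadAct
    rw [← (hsil.sameView hρ hp).th] at htr
    obtain ⟨j, hj, b, hb, hc⟩ := (hrel _).exists_interfering hrun hΘ hjust hai haB htr
    exact ⟨3 * j + 0, by omega, b, (normActs_eq (by omega)).trans hb, hc⟩
  · simp only [Silent, not_forall, not_not] at hsil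
    obtain ⟨i, hi, -, b, hb, hbt⟩ := hsil
    exact ⟨i, hi, b, hb, not_concOf_of_thr_eq hbt.symm⟩

end

theorem normBlock_of_isVis (s : MState Θ) (ha : a.IsVis) :
    normBlock s (some a) 0 = some a := by
  cases a <;> first | rfl | exact ha.elim

theorem eq_of_normBlock_isVis {s : MState Θ} {o : Option (RWAct T R D)} {i : ℕ}
    (h : normBlock s o i = some a) (ha : a.IsVis) : i = 0 ∧ o = some a := by
  unfold normBlock at h
  split at h <;> cases h <;> first | exact ⟨rfl, rfl⟩ | exact ha.elim

theorem RunTrace.normalized {w : ℕ → Option (RWAct T R D)} (h : RunTrace RWAct.IsVis α w) :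
    RunTrace RWAct.IsVis (normActs σ α) w := by
  obtain ⟨m, f, hf, hfi, hnone, hall⟩ := h
  refine ⟨m, fun i => 3 * f i, fun i j hi hj hij => ?_, fun i hi => ?_, hnone,
    fun j a hj ha => ?_⟩
  · have := hf i j hi hj hij
    simpa using this
  · obtain ⟨a, h1, h2, h3⟩ := hfi i hi
    refine ⟨a, (normActs_eq (i := 0) (by omega)).trans ?_, h2, h3⟩
    rw [h1]
    exact normBlock_of_isVis _ h2
  · obtain ⟨h1, h2⟩ := eq_of_normBlock_isVis hj ha
    obtain ⟨i, hi, hij⟩ := hall _ _ h2 ha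
    exact ⟨i, hi, by simp only [hij]; omega⟩

end NormalizedRun

/-- For each memory model `C ∈ {A, I, S}`, the overlap-restricted model `M_C` and the
full-read atomic model `M_FR` are weak completed trace equivalent with respect to
`C`-completeness: `WCT_C(M_C) = WCT_C(M_FR)`. -/
theorem wct_restricted_eq_wct_full
    {T R : Type} {D : R → Type} [DecidableEq T]
    (Θ : ThreadSys T R D) (hΘ : Θ.Good) (d0 : ∀ r, D r)
    (mode : OverlapMode)
    (hmode : mode = OverlapMode.A ∨ mode = OverlapMode.I ∨ mode = OverlapMode.S) :
    WCT (MTrans mode Θ) (Minit Θ d0)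
        (JustPath (MTrans mode Θ) (concOf mode) Blk) RWAct.IsVis =
      WCT (MTrans OverlapMode.FR Θ) (Minit Θ d0)
        (JustPath (MTrans OverlapMode.FR Θ) (concOf mode) Blk) RWAct.IsVis := by
  ext w
  constructor
  · intro hw
    have : Nonempty (RWAct T R D) := hw.elim fun π _ => ⟨π.acts 0⟩
    obtain ⟨σ, α, hrun, hjust, htrace⟩ := exists_run_of_mem_WCT hw
    exact mem_WCT_of_run (hrun.to_FR hΘ) (hjust.to_FR hΘ hmode hrun) htrace
  · intro hw
    have : Nonempty (RWAct T R D) := hw.elim fun π _ => ⟨π.acts 0⟩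
    obtain ⟨σ, α, hrun, hjust, htrace⟩ := exists_run_of_mem_WCT hw
    obtain ⟨ρ, hρ, hbusy, hrel⟩ := exists_normalized_run (mode := mode) hrun hΘ hjust
    exact mem_WCT_of_run hρ (justRun_normalized hrun hΘ hjust hρ hbusy hrel) htrace.normalized
end
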